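/- (Lamperti's criterion.) Let (Z_n) be an irreducible time-homogeneous Markov chain on ℤ≥0, and let μ_k(z) = E[(Z_{n+1} − Z_n)^k | Z_n = z]. Suppose there exists ε > 0 such that sup_z E[|Z_{n+1} − Z_n|^{2+ε} | Z_n = z] < ∞ and liminf_{z→∞} E[|Z_{n+1} − Z_n|² | Z_n = z] > 0. Then: (i) if liminf_{z→∞} (2z μ_1(z) − μ_2(z)) > 0, then (Z_n) is transient; (ii) if |2z μ_1(z)| ≤ μ_2(z) + O(z^{−δ}) for some δ > 0, then (Z_n) is null-recurrent; (iii) if limsup_{z→∞} (2z μ_1(z) + μ_2(z)) < 0, then (Z_n) is positive-recurrent. -/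

import Mathlib

open MeasureTheory Filter Topology Asymptotics
open scoped ENNReal NNReal

/-- A time-homogeneous Markov chain on a measurable state space `E`, encoded via the family
`P z` of laws (on trajectory space) of the chain started at `z`.  The field `markov` is the
time-homogeneous Markov property: conditionally on the event `{ω n = w}` intersected with any
event `B` depending only on the first `n+1` coordinates, the shifted trajectory has law `P w`. -/
structure MChain (E : Type*) [MeasurableSpace E] where
  P : E → MeasureTheory.Measure (ℕ → E)
  isProb : ∀ z, MeasureTheory.IsProbabilityMeasure (P z)
  init : ∀ z, P z {ω | ω 0 = z} = 1
  markov : ∀ (z : E) (n : ℕ) (w : E) (A B : Set (ℕ → E)), MeasurableSet A →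
    (∀ ω ω' : ℕ → E, (∀ k, k ≤ n → ω k = ω' k) → ω ∈ B → ω' ∈ B) →
    P z (B ∩ {ω | ω n = w} ∩ {ω | (fun k => ω (n + k)) ∈ A})
      = P z (B ∩ {ω | ω n = w}) * P w A

namespace MChain

variable {E : Type*} [MeasurableSpace E]

/-- Irreducibility: every state can be reached from every state with positive probability. -/
def Irreducible (X : MChain E) : Prop := ∀ z w : E, ∃ n : ℕ, X.P z {ω | ω n = w} ≠ 0

/-- Recurrence: from every state, the chain returns to it almost surely. -/
def Recurrent (X : MChain E) : Prop := ∀ z : E, X.P z {ω | ∃ n, 1 ≤ n ∧ ω n = z} = 1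

def Transient (X : MChain E) : Prop := ¬ X.Recurrent

/-- The first return time to `z` (with junk value `0`, via `sInf ∅ = 0`, if there is no return). -/
noncomputable def returnTime (z : E) (ω : ℕ → E) : ℕ := sInf {n | 1 ≤ n ∧ ω n = z}

/-- Positive recurrence: recurrent, with finite mean return times. -/
def PositiveRecurrent (X : MChain E) : Prop :=
  X.Recurrent ∧ ∀ z : E, (∫⁻ ω, (returnTime z ω : ℝ≥0∞) ∂(X.P z)) ≠ ⊤

def NullRecurrent (X : MChain E) : Prop := X.Recurrent ∧ ¬ X.PositiveRecurrent

end MChain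

section HalfStrip

variable {S : Type*} [Fintype S] [DecidableEq S] [Nonempty S]
  [MeasurableSpace S] [MeasurableSingletonClass S]

/-- `qhat X x i j` is the probability that the `S`-coordinate moves from `i` to `j` when the
`ℕ`-coordinate is at `x`; this is `q_x(i,j) = Σ_y p(x,i,y,j)` of the paper. -/
noncomputable def qhat (X : MChain (ℕ × S)) (x : ℕ) (i j : S) : ℝ :=
  (X.P (x, i) {ω | (ω 1).2 = j}).toReal

/-- `stepMoment X k x i = μ_k(x,i) = E[(X_{n+1}-X_n)^k | X_n = x, η_n = i]`. -/
noncomputable def stepMoment (X : MChain (ℕ × S)) (k : ℕ) (x : ℕ) (i : S) : ℝ :=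
  ∫ ω, (((ω 1).1 : ℝ) - (x : ℝ)) ^ k ∂(X.P (x, i))

/-- Condition (B_p): uniformly bounded conditional `p`-th moments of the jumps of the
`ℕ`-coordinate (by the Markov property, the conditional moment given `F_n` is a function of
the current state only). -/
def CondB (X : MChain (ℕ × S)) (p : ℝ) : Prop :=
  ∃ C : ℝ≥0∞, C ≠ ⊤ ∧ ∀ (x : ℕ) (i : S),
    (∫⁻ ω, ENNReal.ofReal (|((ω 1).1 : ℝ) - (x : ℝ)| ^ p) ∂(X.P (x, i))) ≤ C

def IsStochasticMatrix (Q : S → S → ℝ) : Prop :=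
  (∀ i j, 0 ≤ Q i j) ∧ ∀ i, (∑ j, Q i j) = 1

def IsIrreducibleMatrix (Q : S → S → ℝ) : Prop :=
  ∀ i j, ∃ n : ℕ, 0 < ((Matrix.of Q) ^ n) i j

/-- Aperiodicity (for a finite irreducible stochastic matrix, eventual positivity of the
diagonal entries of the powers is equivalent to aperiodicity). -/
def IsAperiodicMatrix (Q : S → S → ℝ) : Prop :=
  ∀ i, ∃ N : ℕ, ∀ n, N ≤ n → 0 < ((Matrix.of Q) ^ n) i i

/-- `pst` is a (strictly positive) stationary distribution for `Q`. -/
def IsStationaryDist (Q : S → S → ℝ) (pst : S → ℝ) : Prop :=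
  (∀ i, 0 < pst i) ∧ (∑ i, pst i) = 1 ∧ ∀ j, (∑ i, pst i * Q i j) = pst j

/-- Condition (Q_∞): the transition matrix of the `S`-coordinate converges as `x → ∞` to an
irreducible stochastic matrix `Q`. -/
def CondQ (X : MChain (ℕ × S)) (Q : S → S → ℝ) : Prop :=
  (∀ i j, Tendsto (fun x : ℕ => qhat X x i j) atTop (nhds (Q i j))) ∧
    IsStochasticMatrix Q ∧ IsIrreducibleMatrix Q

/-- Condition (Q_∞^+): as (Q_∞), with a power-law rate of convergence. -/
def CondQplus (X : MChain (ℕ × S)) (Q : S → S → ℝ) : Prop :=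
  (∃ δ₀ : ℝ, 0 < δ₀ ∧ ∀ i j,
      (fun x : ℕ => qhat X x i j - Q i j) =O[atTop] fun x : ℕ => (x : ℝ) ^ (-δ₀)) ∧
    IsStochasticMatrix Q ∧ IsIrreducibleMatrix Q

/-- Condition (M_C): asymptotically constant drifts, `μ₁(x,i) = d_i + o(1)`. -/
def CondMC (X : MChain (ℕ × S)) (d : S → ℝ) : Prop :=
  ∀ i, Tendsto (fun x : ℕ => stepMoment X 1 x i) atTop (nhds (d i))

/-- Condition (M_L): Lamperti-type drifts, `μ₁(x,i) = c_i/x + o(1/x)`, `μ₂(x,i) = s_i² + o(1)`,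
with at least one `s_i²` nonzero. -/
def CondML (X : MChain (ℕ × S)) (c s2 : S → ℝ) : Prop :=
  (∀ i, 0 ≤ s2 i) ∧ (∃ i, s2 i ≠ 0) ∧
    (∀ i, Tendsto (fun x : ℕ => (x : ℝ) * stepMoment X 1 x i) atTop (nhds (c i))) ∧
    (∀ i, Tendsto (fun x : ℕ => stepMoment X 2 x i) atTop (nhds (s2 i)))

/-- Condition (M_L^+): Lamperti-type drifts with power-law error bounds. -/
def CondMLplus (X : MChain (ℕ × S)) (c s2 : S → ℝ) : Prop :=
  (∀ i, 0 ≤ s2 i) ∧ (∃ i, s2 i ≠ 0) ∧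
    ∃ δ₁ : ℝ, 0 < δ₁ ∧ ∀ i,
      ((fun x : ℕ => stepMoment X 1 x i - c i / (x : ℝ)) =O[atTop]
        fun x : ℕ => (x : ℝ) ^ (-1 - δ₁)) ∧
      ((fun x : ℕ => stepMoment X 2 x i - s2 i) =O[atTop] fun x : ℕ => (x : ℝ) ^ (-δ₁))

/-- Successive visit times `τ_0 < τ_1 < ⋯` of the `S`-coordinate to the distinguished state
`s0` (junk value, via `sInf ∅ = 0`, if there is no such visit). -/
noncomputable def tauSeq (s0 : S) (ω : ℕ → ℕ × S) : ℕ → ℕ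
  | 0 => sInf {n | (ω n).2 = s0}
  | m + 1 => sInf {n | tauSeq s0 ω m < n ∧ (ω n).2 = s0}

/-- `τ`, the first positive time at which the `S`-coordinate visits `s0`. -/
noncomputable def tauRet (s0 : S) (ω : ℕ → ℕ × S) : ℕ :=
  sInf {n | 1 ≤ n ∧ (ω n).2 = s0}

/-- `D_n`, the maximal displacement of the `ℕ`-coordinate during the `n`-th excursion. -/
noncomputable def Dexc (s0 : S) (n : ℕ) (ω : ℕ → ℕ × S) : ℕ :=
  Finset.sup (Finset.Icc (tauSeq s0 ω n) (tauSeq s0 ω (n + 1)))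
    fun m => Nat.dist (ω m).1 (ω (tauSeq s0 ω n)).1

/-- `N(n) = max {k : τ_k ≤ n}`. -/
noncomputable def Ncount (s0 : S) (n : ℕ) (ω : ℕ → ℕ × S) : ℕ :=
  sSup {k | tauSeq s0 ω k ≤ n}

end HalfStrip

/-- `Fdist a t` is the distribution function of the square root of a `Gamma(a,t)` random
variable: `F_{a,t}(x) = ∫_0^x 2 u^{2a-1} e^{-u²/t} / (t^a Γ(a)) du`. -/
noncomputable def Fdist (a t x : ℝ) : ℝ :=
  ∫ u in (0:ℝ)..x, 2 * u ^ (2 * a - 1) * Real.exp (-(u ^ 2) / t) / (t ^ a * Real.Gamma a)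


/-- `μ_k(z) = E[(Z_{n+1} − Z_n)^k | Z_n = z]` for a Markov chain on `ℕ`. -/
noncomputable def natMoment (Z : MChain ℕ) (k : ℕ) (z : ℕ) : ℝ :=
  ∫ ω, ((ω 1 : ℝ) - (z : ℝ)) ^ k ∂(Z.P z)

namespace MChain

/-- The law of the first step of the chain started at `x`. -/
noncomputable def step (Z : MChain ℕ) (x : ℕ) : Measure ℕ := (Z.P x).map fun ω => ω 1

instance (Z : MChain ℕ) (x : ℕ) : IsProbabilityMeasure (Z.P x) := Z.isProb x

instance (Z : MChain ℕ) (x : ℕ) : IsProbabilityMeasure (Z.step x) :=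
  Measure.isProbabilityMeasure_map (measurable_pi_apply 1).aemeasurable

/-- The probability, starting from `x`, of not visiting `B` at any of the times `1, …, n`. -/
noncomputable def avoid (Z : MChain ℕ) (B : Set ℕ) (n x : ℕ) : ℝ≥0∞ :=
  Z.P x {ω | ∀ k, 1 ≤ k → k ≤ n → ω k ∉ B}

/-- The probability, starting from `x`, of not visiting `B` at any positive time. -/
noncomputable def escape (Z : MChain ℕ) (B : Set ℕ) (x : ℕ) : ℝ≥0∞ :=
  Z.P x {ω | ∀ k, 1 ≤ k → ω k ∉ B}

lemma measurableSet_avoid (B : Set ℕ) (n : ℕ) :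
    MeasurableSet {ω : ℕ → ℕ | ∀ k, 1 ≤ k → k ≤ n → ω k ∉ B} := by
  have : {ω : ℕ → ℕ | ∀ k, 1 ≤ k → k ≤ n → ω k ∉ B}
      = ⋂ k, ⋂ (_ : 1 ≤ k), ⋂ (_ : k ≤ n), (fun ω : ℕ → ℕ => ω k) ⁻¹' Bᶜ := by
    ext; simp
  rw [this]
  exact .iInter fun k => .iInter fun _ => .iInter fun _ =>
    measurable_pi_apply k (.of_discrete)

lemma measurableSet_escape (B : Set ℕ) :
    MeasurableSet {ω : ℕ → ℕ | ∀ k, 1 ≤ k → ω k ∉ B} := by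
  have : {ω : ℕ → ℕ | ∀ k, 1 ≤ k → ω k ∉ B}
      = ⋂ k, ⋂ (_ : 1 ≤ k), (fun ω : ℕ → ℕ => ω k) ⁻¹' Bᶜ := by
    ext; simp
  rw [this]
  exact .iInter fun k => .iInter fun _ => measurable_pi_apply k (.of_discrete)

variable (Z : MChain ℕ)

lemma lintegral_step (x : ℕ) (g : ℕ → ℝ≥0∞) :
    ∫⁻ w, g w ∂Z.step x = ∫⁻ ω, g (ω 1) ∂Z.P x :=
  lintegral_map (.of_discrete) (measurable_pi_apply 1)

lemma integral_step (x : ℕ) (g : ℕ → ℝ) :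
    ∫ w, g w ∂Z.step x = ∫ ω, g (ω 1) ∂Z.P x :=
  integral_map (measurable_pi_apply 1).aemeasurable
    (Measurable.of_discrete.aestronglyMeasurable)

/-- The Markov property at time `1`. -/
lemma measure_step_inter (x : ℕ) (C : Set ℕ) {A : Set (ℕ → ℕ)} (hA : MeasurableSet A) :
    Z.P x {ω | ω 1 ∈ C ∧ (fun k => ω (1 + k)) ∈ A} = ∫⁻ w in C, Z.P w A ∂Z.step x := by
  have hsh : Measurable fun (ω : ℕ → ℕ) k => ω (1 + k) :=
    measurable_pi_lambda _ fun k => measurable_pi_apply _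
  have h1 (w : ℕ) : MeasurableSet {ω : ℕ → ℕ | ω 1 = w} :=
    measurable_pi_apply (X := fun _ : ℕ => ℕ) 1 (measurableSet_singleton w)
  have hE : {ω : ℕ → ℕ | ω 1 ∈ C ∧ (fun k => ω (1 + k)) ∈ A}
      = ⋃ w, {ω | w ∈ C} ∩ {ω | ω 1 = w} ∩ {ω | (fun k => ω (1 + k)) ∈ A} := by
    ext ω
    simp
  rw [hE, measure_iUnion]
  · rw [← lintegral_indicator (.of_discrete), lintegral_countable']
    refine tsum_congr fun w => ?_
    have hw : Z.step x {w} = Z.P x {ω | ω 1 = w} :=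
      Measure.map_apply (measurable_pi_apply 1) (measurableSet_singleton w)
    rw [Z.markov x 1 w A _ hA (fun _ _ _ h => h), hw]
    by_cases h : w ∈ C <;> simp [h, mul_comm]
  · intro a b hab
    rw [Function.onFun, Set.disjoint_left]
    rintro ω ⟨⟨-, h⟩, -⟩ ⟨⟨-, h'⟩, -⟩
    exact hab (h.symm.trans h')
  · exact fun w => ((MeasurableSet.const _).inter (h1 w)).inter (hsh hA)

lemma avoid_zero (B : Set ℕ) (x : ℕ) : Z.avoid B 0 x = 1 := by
  have : {ω : ℕ → ℕ | ∀ k, 1 ≤ k → k ≤ 0 → ω k ∉ B} = Set.univ := by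
    ext ω
    simp only [Set.mem_ofPred_eq, Set.mem_univ, iff_true]
    omega
  rw [avoid, this, measure_univ]

lemma avoid_succ (B : Set ℕ) (n x : ℕ) :
    Z.avoid B (n + 1) x = ∫⁻ w in Bᶜ, Z.avoid B n w ∂Z.step x := by
  unfold avoid
  rw [← Z.measure_step_inter x Bᶜ (measurableSet_avoid B n)]
  congr 1
  ext ω
  constructor
  · exact fun h => ⟨h 1 le_rfl (by omega), fun k hk hkn => h (1 + k) (by omega) (by omega)⟩
  · rintro ⟨h1, h2⟩ k hk hkn
    rcases hk.eq_or_lt with rfl | hk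
    · exact h1
    · obtain ⟨j, rfl⟩ := Nat.exists_eq_add_of_le hk.le
      exact h2 j (by omega) (by omega)

lemma escape_eq (B : Set ℕ) (x : ℕ) :
    Z.escape B x = ∫⁻ w in Bᶜ, Z.escape B w ∂Z.step x := by
  unfold escape
  rw [← Z.measure_step_inter x Bᶜ (measurableSet_escape B)]
  congr 1
  ext ω
  constructor
  · exact fun h => ⟨h 1 le_rfl, fun k hk => h (1 + k) (by omega)⟩
  · rintro ⟨h1, h2⟩ k hk
    rcases hk.eq_or_lt with rfl | hk
    · exact h1
    · obtain ⟨j, rfl⟩ := Nat.exists_eq_add_of_le hk.le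
      exact h2 j (by omega)

lemma avoid_le_one (B : Set ℕ) (n x : ℕ) : Z.avoid B n x ≤ 1 := prob_le_one

lemma escape_le_one (B : Set ℕ) (x : ℕ) : Z.escape B x ≤ 1 := prob_le_one

lemma avoid_antitone (n x : ℕ) {B B' : Set ℕ} (h : B ⊆ B') :
    Z.avoid B' n x ≤ Z.avoid B n x :=
  measure_mono fun _ hω k hk hkn hB => hω k hk hkn (h hB)

lemma escape_antitone (x : ℕ) {B B' : Set ℕ} (h : B ⊆ B') :
    Z.escape B' x ≤ Z.escape B x :=
  measure_mono fun _ hω k hk hB => hω k hk (h hB)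

lemma tendsto_avoid (B : Set ℕ) (x : ℕ) :
    Tendsto (fun n => Z.avoid B n x) atTop (𝓝 (Z.escape B x)) := by
  have : {ω : ℕ → ℕ | ∀ k, 1 ≤ k → ω k ∉ B}
      = ⋂ n, {ω : ℕ → ℕ | ∀ k, 1 ≤ k → k ≤ n → ω k ∉ B} := by
    ext ω
    simp only [Set.mem_ofPred_eq, Set.mem_iInter]
    exact ⟨fun h n k hk _ => h k hk, fun h k hk => h k k hk le_rfl⟩
  unfold avoid escape
  rw [this]
  exact tendsto_measure_iInter_atTop (fun n => (measurableSet_avoid B n).nullMeasurableSet)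
    (fun m n hmn ω h k hk hkm => h k hk (hkm.trans hmn)) ⟨0, measure_ne_top _ _⟩

lemma recurrent_iff_escape : Z.Recurrent ↔ ∀ x, Z.escape {x} x = 0 := by
  refine forall_congr' fun x => ?_
  have : {ω : ℕ → ℕ | ∃ n, 1 ≤ n ∧ ω n = x} = {ω : ℕ → ℕ | ∀ k, 1 ≤ k → ω k ∉ ({x} : Set ℕ)}ᶜ := by
    ext ω
    simp
  rw [this, prob_compl_eq_one_iff (measurableSet_escape _)]
  rfl

lemma returnTime_le_tsum (x : ℕ) (ω : ℕ → ℕ) :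
    (returnTime x ω : ℝ≥0∞) ≤
      ∑' n, {ω : ℕ → ℕ | ∀ k, 1 ≤ k → k ≤ n → ω k ∉ ({x} : Set ℕ)}.indicator 1 ω := by
  refine le_trans ?_ (ENNReal.sum_le_tsum (Finset.range (returnTime x ω)))
  rw [Finset.sum_congr rfl (g := fun _ => (1 : ℝ≥0∞))]
  · simp
  · intro n hn
    rw [Set.indicator_of_mem]
    · rfl
    · intro k hk hkn hx
      have : returnTime x ω ≤ k := Nat.sInf_le ⟨hk, hx⟩
      have := Finset.mem_range.1 hn
      omega

lemma tsum_le_returnTime {x : ℕ} {ω : ℕ → ℕ} (h : ∃ n, 1 ≤ n ∧ ω n = x) :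
    ∑' n, {ω : ℕ → ℕ | ∀ k, 1 ≤ k → k ≤ n → ω k ∉ ({x} : Set ℕ)}.indicator 1 ω
      ≤ (returnTime x ω : ℝ≥0∞) := by
  have hmem : 1 ≤ returnTime x ω ∧ ω (returnTime x ω) = x :=
    Nat.sInf_mem (s := {n | 1 ≤ n ∧ ω n = x}) h
  rw [tsum_eq_sum (s := Finset.range (returnTime x ω))]
  · refine (Finset.sum_le_sum (g := fun _ => (1 : ℝ≥0∞)) fun n _ => ?_).trans (by simp)
    exact Set.indicator_le_self' (by simp) ω
  · intro n hn
    refine Set.indicator_of_notMem (fun hω => ?_) _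
    exact hω _ hmem.1 (by simpa using hn) hmem.2

lemma tsum_avoid_eq_lintegral (B : Set ℕ) (x : ℕ) :
    ∑' n, Z.avoid B n x
      = ∫⁻ ω, ∑' n, {ω : ℕ → ℕ | ∀ k, 1 ≤ k → k ≤ n → ω k ∉ B}.indicator 1 ω ∂Z.P x := by
  rw [lintegral_tsum]
  · refine tsum_congr fun n => ?_
    rw [lintegral_indicator_one (measurableSet_avoid B n)]
    rfl
  · exact fun n => (measurable_one.indicator (measurableSet_avoid B n)).aemeasurable

lemma lintegral_returnTime_le (x : ℕ) :
    ∫⁻ ω, (returnTime x ω : ℝ≥0∞) ∂Z.P x ≤ ∑' n, Z.avoid {x} n x := by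
  rw [tsum_avoid_eq_lintegral]
  exact lintegral_mono fun ω => returnTime_le_tsum x ω

lemma tsum_avoid_le_lintegral_returnTime (hZ : Z.Recurrent) (x : ℕ) :
    ∑' n, Z.avoid {x} n x ≤ ∫⁻ ω, (returnTime x ω : ℝ≥0∞) ∂Z.P x := by
  rw [tsum_avoid_eq_lintegral]
  refine lintegral_mono_ae ?_
  have h : ∀ᵐ ω ∂Z.P x, ω ∉ {ω : ℕ → ℕ | ∀ k, 1 ≤ k → ω k ∉ ({x} : Set ℕ)} :=
    measure_eq_zero_iff_ae_notMem.1 ((Z.recurrent_iff_escape).1 hZ x)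
  filter_upwards [h] with ω hω
  exact tsum_le_returnTime (by simpa using hω)

lemma tsum_avoid_eq (B : Set ℕ) (x : ℕ) :
    ∑' n, Z.avoid B n x = 1 + ∫⁻ w in Bᶜ, ∑' n, Z.avoid B n w ∂Z.step x := by
  rw [tsum_eq_zero_add' ENNReal.summable, avoid_zero,
    lintegral_tsum fun n => Measurable.of_discrete.aemeasurable]
  simp_rw [avoid_succ]

variable {Z}

/-- A nonempty set which the chain cannot leave in one step is the whole space. -/
lemma Irreducible.mem_of_closed (hirr : Z.Irreducible) {U : Set ℕ} {x₀ : ℕ} (hx₀ : x₀ ∈ U)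
    (hU : ∀ x ∈ U, ∀ᵐ w ∂Z.step x, w ∈ U) (x : ℕ) : x ∈ U := by
  have key : ∀ n, Z.P x₀ {ω | ω n ∉ U} = 0 := by
    intro n
    induction n with
    | zero =>
      refine measure_mono_null (t := {ω | ω 0 = x₀}ᶜ) ?_ ?_
      · intro ω hω h
        exact hω (by rw [h]; exact hx₀)
      · rw [prob_compl_eq_zero_iff]
        · exact Z.init x₀
        · exact measurable_pi_apply (X := fun _ : ℕ => ℕ) 0 (measurableSet_singleton x₀)
    | succ n ih =>
      have hsub : {ω : ℕ → ℕ | ω (n + 1) ∉ U} ⊆ {ω | ω n ∉ U} ∪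
          ⋃ w ∈ U, (Set.univ ∩ {ω | ω n = w} ∩ {ω | (fun k => ω (n + k)) ∈ {ω | ω 1 ∉ U}}) := by
        intro ω hω
        by_cases h : ω n ∈ U
        · exact Or.inr (Set.mem_biUnion h ⟨⟨trivial, rfl⟩, hω⟩)
        · exact Or.inl h
      refine measure_mono_null hsub (measure_union_null ih ?_)
      refine (measure_biUnion_null_iff U.to_countable).2 fun w hw => ?_
      have hm : MeasurableSet {ω : ℕ → ℕ | ω 1 ∉ U} :=
        measurable_pi_apply (X := fun _ : ℕ => ℕ) 1 (MeasurableSet.of_discrete (s := Uᶜ))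
      rw [Z.markov x₀ n w _ _ hm (fun _ _ _ h => h)]
      have h0 : Z.P w {ω | ω 1 ∉ U} = 0 := by
        have := hU w hw
        rw [ae_iff, step, Measure.map_apply (measurable_pi_apply 1) .of_discrete] at this
        exact this
      rw [h0, mul_zero]
  by_contra hx
  obtain ⟨n, hn⟩ := hirr x₀ x
  refine hn (measure_mono_null (fun ω (hω : ω n = x) => ?_) (key n))
  rw [Set.mem_ofPred_eq, hω]
  exact hx

/-- Maximum principle: a function which attains its maximum and is subharmonic off the nonempty
set `A` attains its maximum on `A`. -/
lemma Irreducible.exists_mem_eq_max (hirr : Z.Irreducible) {A : Set ℕ} (hA : A.Nonempty)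
    {u : ℕ → ℝ} {x₀ : ℕ} (hmax : ∀ x, u x ≤ u x₀)
    (hu : ∀ x ∉ A, Integrable u (Z.step x) ∧ u x ≤ ∫ w, u w ∂Z.step x) :
    ∃ a ∈ A, u a = u x₀ := by
  by_contra! hne
  obtain ⟨a, ha⟩ := hA
  refine hne a ha (hirr.mem_of_closed (U := {x | u x = u x₀}) rfl (fun x hx => ?_) a)
  have hxA : x ∉ A := fun h => hne x h hx
  obtain ⟨hi, hle⟩ := hu x hxA
  have hint : Integrable (fun w => u x₀ - u w) (Z.step x) := (integrable_const _).sub hi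
  have h0 : ∫ w, (u x₀ - u w) ∂Z.step x = 0 := by
    refine le_antisymm ?_ (integral_nonneg fun w => sub_nonneg.2 (hmax w))
    rw [integral_sub (integrable_const _) hi]
    have : u x = u x₀ := hx
    simp
    linarith
  have := (integral_eq_zero_iff_of_nonneg (fun w => sub_nonneg.2 (hmax w)) hint).1 h0
  filter_upwards [this] with w hw
  have : u x₀ - u w = 0 := hw
  exact (sub_eq_zero.1 this).symm

lemma Recurrent.escape_eq_zero (hrec : Z.Recurrent) (hirr : Z.Irreducible) (z x : ℕ) :
    Z.escape {z} x = 0 := by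
  refine hirr.mem_of_closed (U := {x | Z.escape {z} x = 0}) (x₀ := z)
    (Z.recurrent_iff_escape.1 hrec z) (fun x hx => ?_) x
  have hx' : Z.escape {z} x = 0 := hx
  rw [escape_eq, lintegral_eq_zero_iff .of_discrete] at hx'
  have h := (ae_restrict_iff' (.of_discrete)).1 hx'
  filter_upwards [h] with w hw
  by_cases hwz : w = z
  · rw [hwz]
    exact Z.recurrent_iff_escape.1 hrec z
  · exact hw hwz

/-- A nonnegative function which is superharmonic off `A` and takes values below its bound on `A`
witnesses transience. -/
lemma transient_of_superharmonic (hirr : Z.Irreducible) {A : Set ℕ} (hA : A.Nonempty)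
    {f : ℕ → ℝ≥0∞} {m : ℝ≥0∞} (hm : m ≠ ⊤) (hfA : ∀ a ∈ A, m ≤ f a)
    (hf : ∀ x ∉ A, ∫⁻ w, f w ∂Z.step x ≤ f x) {x₀ : ℕ} (hx₀ : x₀ ∉ A) (hlt : f x₀ < m) :
    Z.Transient := by
  intro hrec
  obtain ⟨a, ha⟩ := hA
  have hesc : Z.escape A x₀ = 0 :=
    le_antisymm ((Z.escape_antitone x₀ (Set.singleton_subset_iff.2 ha)).trans
      (hrec.escape_eq_zero hirr a x₀).le) zero_le
  have key : ∀ n, ∀ x ∉ A, m ≤ f x + m * Z.avoid A n x := by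
    intro n
    induction n with
    | zero => intro x _; rw [avoid_zero, mul_one]; exact le_add_self
    | succ n ih =>
      intro x hx
      calc m = ∫⁻ _, m ∂Z.step x := by simp
        _ = ∫⁻ _ in A, m ∂Z.step x + ∫⁻ _ in Aᶜ, m ∂Z.step x :=
          (lintegral_add_compl _ .of_discrete).symm
        _ ≤ ∫⁻ w in A, f w ∂Z.step x + ∫⁻ w in Aᶜ, (f w + m * Z.avoid A n w) ∂Z.step x :=
          add_le_add (setLIntegral_mono' .of_discrete hfA) (setLIntegral_mono' .of_discrete ih)
        _ = ∫⁻ w, f w ∂Z.step x + m * Z.avoid A (n + 1) x := by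
          rw [lintegral_add_left .of_discrete, lintegral_const_mul _ .of_discrete, ← avoid_succ,
            ← add_assoc, lintegral_add_compl _ .of_discrete]
        _ ≤ _ := by gcongr; exact hf x hx
  have hlim : Tendsto (fun n => f x₀ + m * Z.avoid A n x₀) atTop (𝓝 (f x₀ + m * 0)) := by
    refine Tendsto.const_add _ (ENNReal.Tendsto.const_mul ?_ (Or.inr hm))
    rw [← hesc]
    exact Z.tendsto_avoid A x₀
  have := ge_of_tendsto' hlim fun n => key n x₀ hx₀
  rw [mul_zero, add_zero] at this
  exact absurd hlt this.not_gt

/-- A nonnegative function which tends to infinity and is superharmonic off a finite set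
witnesses recurrence. -/
lemma recurrent_of_superharmonic (hirr : Z.Irreducible) {A : Set ℕ} (hA : A.Nonempty)
    (hAfin : A.Finite) {f : ℕ → ℝ} (hf0 : ∀ x, 0 ≤ f x) (hftop : Tendsto f atTop atTop)
    (hf : ∀ x ∉ A, Integrable f (Z.step x) ∧ ∫ w, f w ∂Z.step x ≤ f x) : Z.Recurrent := by
  rw [recurrent_iff_escape]
  intro z
  have hesc_ne (w) : Z.escape {z} w ≠ ⊤ := ((Z.escape_le_one _ w).trans_lt ENNReal.one_lt_top).ne
  let h : ℕ → ℝ := fun x => ({z}ᶜ : Set ℕ).indicator (fun x => (Z.escape {z} x).toReal) x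
  have hz : h z = 0 := Set.indicator_of_notMem (by simp) _
  have hne : ∀ x, x ≠ z → h x = (Z.escape {z} x).toReal := fun x hx =>
    Set.indicator_of_mem (by simpa using hx) _
  have h0 : ∀ x, 0 ≤ h x := fun x => Set.indicator_nonneg (fun _ _ => ENNReal.toReal_nonneg) x
  have h1 : ∀ x, h x ≤ 1 := by
    intro x
    by_cases hx : x = z
    · rw [hx, hz]; exact zero_le_one
    · rw [hne x hx]
      exact ENNReal.toReal_le_of_le_ofReal zero_le_one (by simpa using Z.escape_le_one _ x)
  have hint : ∀ x, Integrable h (Z.step x) := fun x =>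
    Integrable.of_bound Measurable.of_discrete.aestronglyMeasurable 1
      (Eventually.of_forall fun w => by rw [Real.norm_of_nonneg (h0 w)]; exact h1 w)
  have hharm : ∀ x, (Z.escape {z} x).toReal = ∫ w, h w ∂Z.step x := by
    intro x
    rw [escape_eq, integral_indicator .of_discrete, integral_toReal .of_discrete]
    exact Eventually.of_forall fun w => (hesc_ne w).lt_top
  have hsub : ∀ x, h x ≤ ∫ w, h w ∂Z.step x := by
    intro x
    by_cases hx : x = z
    · rw [hx, hz]; exact integral_nonneg h0
    · rw [hne x hx, hharm]
  obtain ⟨a, haA, ha⟩ := hAfin.exists_maximalFor h A hA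
  have hamax : ∀ b ∈ A, h b ≤ h a := fun b hb => by
    by_contra hlt
    exact hlt (ha hb (not_le.1 hlt).le)
  have hglob : ∀ x, h x ≤ h a := by
    intro x
    refine le_of_forall_pos_le_add fun e he => ?_
    obtain ⟨ε, hε, hεe⟩ : ∃ ε > 0, ε * f x ≤ e := by
      refine ⟨e / (f x + 1), div_pos he (by linarith [hf0 x]), ?_⟩
      rw [div_mul_eq_mul_div, div_le_iff₀ (by linarith [hf0 x])]
      nlinarith [hf0 x]
    let u : ℕ → ℝ := fun x => h x - ε * f x
    have hu : Tendsto u atTop atBot := by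
      refine tendsto_atBot_mono (f := fun x => 1 + -(ε * f x)) (fun x => ?_) ?_
      · simp only [u]; linarith [h1 x]
      · exact tendsto_const_nhds.add_atBot (tendsto_neg_atTop_atBot.comp (hftop.const_mul_atTop hε))
    obtain ⟨x₀, hx₀⟩ : ∃ x₀, ∀ y, u y ≤ u x₀ :=
      (continuous_of_discreteTopology (f := u)).exists_forall_ge
        (by rwa [cocompact_eq_cofinite, Nat.cofinite_eq_atTop])
    obtain ⟨b, hb, hbu⟩ := hirr.exists_mem_eq_max hA hx₀ fun y hy => by
      obtain ⟨hi, hle⟩ := hf y hy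
      refine ⟨(hint y).sub (hi.const_mul ε), ?_⟩
      have : ∫ w, u w ∂Z.step y = ∫ w, h w ∂Z.step y - ε * ∫ w, f w ∂Z.step y := by
        rw [← integral_const_mul, ← integral_sub (hint y) (hi.const_mul ε)]
      rw [this]
      have := mul_le_mul_of_nonneg_left hle hε.le
      simp only [u]
      linarith [hsub y]
    have hxb : u x ≤ u b := hbu ▸ hx₀ x
    have := mul_nonneg hε.le (hf0 b)
    simp only [u] at hxb
    linarith [hamax b hb]
  obtain ⟨b, hb, hbu⟩ := hirr.exists_mem_eq_max (A := {z}) (Set.singleton_nonempty z) hglob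
    fun y _ => ⟨hint y, hsub y⟩
  have hb' : b = z := hb
  rw [hb', hz] at hbu
  have hzero : ∀ x, h x = 0 := fun x => le_antisymm (hbu ▸ hglob x) (h0 x)
  have := hharm z
  simp only [hzero, integral_zero] at this
  exact ((ENNReal.toReal_eq_zero_iff _).1 this).resolve_right (hesc_ne z)

/-- Foster's criterion for a single target state. -/
lemma tsum_avoid_ne_top {z : ℕ} {g : ℕ → ℝ≥0∞}
    (hg : ∀ x ≠ z, ∫⁻ w, g w ∂Z.step x + 1 ≤ g x) (hz : ∫⁻ w, g w ∂Z.step z ≠ ⊤) :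
    ∑' n, Z.avoid {z} n z ≠ ⊤ := by
  have key : ∀ n, ∀ x ≠ z, ∑ k ∈ Finset.range n, Z.avoid {z} k x ≤ g x := by
    intro n
    induction n with
    | zero => intro x _; simp
    | succ n ih =>
      intro x hx
      rw [Finset.sum_range_succ', avoid_zero]
      simp_rw [avoid_succ]
      rw [← lintegral_finsetSum _ fun _ _ => .of_discrete]
      refine le_trans (add_le_add_left ?_ 1) (hg x hx)
      exact (setLIntegral_mono' .of_discrete ih).trans (setLIntegral_le_lintegral _ _)
  rw [tsum_avoid_eq]
  refine ENNReal.add_ne_top.2 ⟨ENNReal.one_ne_top, ne_top_of_le_ne_top hz ?_⟩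
  refine (setLIntegral_mono' .of_discrete fun x hx => ?_).trans (setLIntegral_le_lintegral _ _)
  exact ENNReal.tsum_le_of_sum_range_le fun n => key n x hx

/-- Foster's criterion: positive recurrence from a drift towards a finite set. -/
lemma Recurrent.positiveRecurrent_of_drift (hrec : Z.Recurrent) (hirr : Z.Irreducible)
    {A : Set ℕ} (hAfin : A.Finite) {f : ℕ → ℝ≥0∞} (hftop : ∀ x, ∫⁻ w, f w ∂Z.step x ≠ ⊤)
    (hf : ∀ x ∉ A, ∫⁻ w, f w ∂Z.step x + 1 ≤ f x) : Z.PositiveRecurrent := by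
  refine ⟨hrec, fun z => ne_top_of_le_ne_top ?_ (Z.lintegral_returnTime_le z)⟩
  obtain ⟨m, hm⟩ : ∃ m, ∀ x ∈ A, Z.avoid {z} m x ≤ 2⁻¹ := by
    have : ∀ x ∈ A, ∀ᶠ m in atTop, Z.avoid {z} m x ≤ 2⁻¹ := by
      intro x _
      have h := Z.tendsto_avoid {z} x
      rw [hrec.escape_eq_zero hirr] at h
      exact h.eventually_le_const (by simp)
    exact ((hAfin.eventually_all).2 this).exists
  let φ : ℕ → ℝ≥0∞ := fun x => ({z}ᶜ : Set ℕ).indicator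
    (fun x => ∑ k ∈ Finset.range m, Z.avoid {z} k x) x
  have hφint : ∀ x, ∫⁻ w, φ w ∂Z.step x = ∑ k ∈ Finset.range m, Z.avoid {z} (k + 1) x := by
    intro x
    rw [lintegral_indicator .of_discrete, lintegral_finsetSum _ fun _ _ => .of_discrete]
    simp_rw [avoid_succ]
  have hφfin : ∀ x, ∫⁻ w, φ w ∂Z.step x ≠ ⊤ := by
    intro x
    rw [hφint]
    exact ENNReal.sum_ne_top.2 fun k _ =>
      ((Z.avoid_le_one _ _ x).trans_lt ENNReal.one_lt_top).ne
  have hφ : ∀ x ≠ z, ∫⁻ w, φ w ∂Z.step x + 1 = φ x + Z.avoid {z} m x := by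
    intro x hx
    have hφx : φ x = ∑ k ∈ Finset.range m, Z.avoid {z} k x :=
      Set.indicator_of_mem (by simpa using hx) _
    rw [hφint, hφx, ← Finset.sum_range_succ, Finset.sum_range_succ', avoid_zero]
  have hφ_le : ∀ x ≠ z, ∫⁻ w, φ w ∂Z.step x ≤ φ x := by
    intro x hx
    refine (ENNReal.add_le_add_iff_right ENNReal.one_ne_top).1 ?_
    rw [hφ x hx]
    gcongr
    exact Z.avoid_le_one _ _ x
  have hφ_drift : ∀ x ∈ A, x ≠ z → ∫⁻ w, φ w ∂Z.step x + 2⁻¹ ≤ φ x := by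
    intro x hxA hx
    refine (ENNReal.add_le_add_iff_right (a := 2⁻¹) (by simp)).1 ?_
    rw [add_assoc, ENNReal.inv_two_add_inv_two, hφ x hx]
    gcongr
    exact hm x hxA
  let b : ℝ≥0∞ := 2 * (∑ a ∈ hAfin.toFinset, ∫⁻ w, f w ∂Z.step a + 1)
  have hb : b ≠ ⊤ := ENNReal.mul_ne_top (by simp)
    (ENNReal.add_ne_top.2 ⟨ENNReal.sum_ne_top.2 fun a _ => hftop a, by simp⟩)
  have hgint : ∀ x, ∫⁻ w, (f w + b * φ w) ∂Z.step x
      = ∫⁻ w, f w ∂Z.step x + b * ∫⁻ w, φ w ∂Z.step x := fun x => by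
    rw [lintegral_add_left .of_discrete, lintegral_const_mul _ .of_discrete]
  refine tsum_avoid_ne_top (g := fun x => f x + b * φ x) (fun x hx => ?_) ?_
  · rw [hgint]
    by_cases hxA : x ∈ A
    · have hsum : ∫⁻ w, f w ∂Z.step x + 1 ≤ b * 2⁻¹ := by
        have : b * 2⁻¹ = ∑ a ∈ hAfin.toFinset, ∫⁻ w, f w ∂Z.step a + 1 := by
          rw [mul_comm, ← mul_assoc, ENNReal.inv_mul_cancel (by simp) (by simp), one_mul]
        rw [this]
        gcongr
        exact Finset.single_le_sum (f := fun a => ∫⁻ w, f w ∂Z.step a) (fun _ _ => zero_le)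
          (hAfin.mem_toFinset.2 hxA)
      calc _ = (∫⁻ w, f w ∂Z.step x + 1) + b * ∫⁻ w, φ w ∂Z.step x := by ring
        _ ≤ b * 2⁻¹ + b * ∫⁻ w, φ w ∂Z.step x := by gcongr
        _ = b * (∫⁻ w, φ w ∂Z.step x + 2⁻¹) := by ring
        _ ≤ b * φ x := by gcongr; exact hφ_drift x hxA hx
        _ ≤ _ := le_add_self
    · calc _ = (∫⁻ w, f w ∂Z.step x + 1) + b * ∫⁻ w, φ w ∂Z.step x := by ring
        _ ≤ _ := by gcongr; exacts [hf x hxA, hφ_le x hx]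
  · rw [hgint]
    exact ENNReal.add_ne_top.2 ⟨hftop z, ENNReal.mul_ne_top hb (hφfin z)⟩

lemma one_le_tsum_avoid (A : Set ℕ) (x : ℕ) : 1 ≤ ∑' n, Z.avoid A n x := by
  rw [← Z.avoid_zero A x]
  exact ENNReal.le_tsum 0

/-- A bounded function whose drift off `A` is at least `-C` gives a lower bound for the mean
hitting time of `A`. -/
lemma le_add_mul_tsum_avoid {A : Set ℕ} {u : ℕ → ℝ≥0∞} {C L M : ℝ≥0∞} (hL : L ≠ ⊤)
    (huL : ∀ x, u x ≤ L) (huM : ∀ a ∈ A, u a ≤ M)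
    (hu : ∀ x ∉ A, u x ≤ ∫⁻ w, u w ∂Z.step x + C) {x : ℕ} (hx : x ∉ A)
    (hfin : ∑' n, Z.avoid A n x ≠ ⊤) : u x ≤ M + C * ∑' n, Z.avoid A n x := by
  have key : ∀ n, ∀ x ∉ A,
      u x ≤ M + (C * ∑ k ∈ Finset.range n, Z.avoid A k x + L * Z.avoid A n x) := by
    intro n
    induction n with
    | zero =>
      intro x _
      rw [avoid_zero, mul_one]
      exact (huL x).trans (le_add_self.trans le_add_self)
    | succ n ih =>
      intro x hx
      calc u x ≤ ∫⁻ w, u w ∂Z.step x + C := hu x hx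
        _ = ∫⁻ w in A, u w ∂Z.step x + ∫⁻ w in Aᶜ, u w ∂Z.step x + C := by
          rw [lintegral_add_compl _ .of_discrete]
        _ ≤ ∫⁻ _ in A, M ∂Z.step x + ∫⁻ w in Aᶜ, (M + (C * ∑ k ∈ Finset.range n, Z.avoid A k w
              + L * Z.avoid A n w)) ∂Z.step x + C := by
          gcongr ?_ + ?_ + C
          exacts [setLIntegral_mono' .of_discrete huM, setLIntegral_mono' .of_discrete ih]
        _ = M + (C * ∑ k ∈ Finset.range (n + 1), Z.avoid A k x + L * Z.avoid A (n + 1) x) := by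
          rw [lintegral_add_left .of_discrete, lintegral_add_left .of_discrete,
            lintegral_const_mul _ .of_discrete, lintegral_const_mul _ .of_discrete,
            lintegral_finsetSum _ fun _ _ => .of_discrete, ← avoid_succ, ← add_assoc,
            lintegral_add_compl _ .of_discrete, Finset.sum_range_succ', avoid_zero]
          simp_rw [← avoid_succ]
          simp only [lintegral_const, measure_univ, mul_one]
          ring
  have hlim : Tendsto (fun n => M + (C * ∑' k, Z.avoid A k x + L * Z.avoid A n x)) atTop
      (𝓝 (M + (C * ∑' k, Z.avoid A k x + L * 0))) :=
    ((ENNReal.Tendsto.const_mul (ENNReal.tendsto_atTop_zero_of_tsum_ne_top hfin)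
      (Or.inr hL)).const_add _).const_add _
  rw [mul_zero, add_zero] at hlim
  refine ge_of_tendsto' hlim fun n => (key n x hx).trans ?_
  gcongr
  exact ENNReal.sum_le_tsum _

/-- If mean return times are finite, then so are the mean hitting times of a nonempty set. -/
lemma PositiveRecurrent.tsum_avoid_ne_top (hpos : Z.PositiveRecurrent) (hirr : Z.Irreducible)
    {A : Set ℕ} (hA : A.Nonempty) (x : ℕ) : ∑' n, Z.avoid A n x ≠ ⊤ := by
  obtain ⟨a, ha⟩ := hA
  refine ne_top_of_le_ne_top ?_
    (ENNReal.tsum_le_tsum fun n => Z.avoid_antitone n x (Set.singleton_subset_iff.2 ha))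
  have ha : ∑' n, Z.avoid {a} n a ≠ ⊤ :=
    ne_top_of_le_ne_top (hpos.2 a) (Z.tsum_avoid_le_lintegral_returnTime hpos.1 a)
  refine hirr.mem_of_closed (U := {x | ∑' n, Z.avoid {a} n x ≠ ⊤}) ha (fun x hx => ?_) x
  have hx' : ∑' n, Z.avoid {a} n x ≠ ⊤ := hx
  rw [tsum_avoid_eq] at hx'
  have h := ae_lt_top' Measurable.of_discrete.aemeasurable (ENNReal.add_ne_top.1 hx').2
  filter_upwards [(ae_restrict_iff' (.of_discrete)).1 h] with w hw
  by_cases hwa : w = a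
  · rwa [hwa]
  · exact (hw hwa).ne

/-- A function which is subharmonic off `A`, dominated by the mean hitting time of `A`, and
somewhere larger than its bound on `A` excludes positive recurrence. -/
lemma not_positiveRecurrent_of_subharmonic (hirr : Z.Irreducible) {A : Set ℕ} (hA : A.Nonempty)
    {f : ℕ → ℝ≥0∞} {K M : ℝ≥0∞} (hK : K ≠ ⊤) (hfA : ∀ a ∈ A, f a ≤ M)
    (hf : ∀ x ∉ A, f x ≤ ∫⁻ w, f w ∂Z.step x)
    (hgrowth : Z.PositiveRecurrent → ∀ x ∉ A, f x ≤ K * ∑' n, Z.avoid A n x)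
    {x₀ : ℕ} (hx₀ : x₀ ∉ A) (hlt : M < f x₀) : ¬ Z.PositiveRecurrent := by
  intro hpos
  have key : ∀ n, ∀ x ∉ A, f x ≤ M + K * ∑' k, Z.avoid A (k + n) x := by
    intro n
    induction n with
    | zero => exact fun x hx => (hgrowth hpos x hx).trans le_add_self
    | succ n ih =>
      intro x hx
      calc f x ≤ ∫⁻ w, f w ∂Z.step x := hf x hx
        _ = ∫⁻ w in A, f w ∂Z.step x + ∫⁻ w in Aᶜ, f w ∂Z.step x :=
          (lintegral_add_compl _ .of_discrete).symm
        _ ≤ ∫⁻ _ in A, M ∂Z.step x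
            + ∫⁻ w in Aᶜ, (M + K * ∑' k, Z.avoid A (k + n) w) ∂Z.step x :=
          add_le_add (setLIntegral_mono' .of_discrete hfA) (setLIntegral_mono' .of_discrete ih)
        _ = M + K * ∑' k, Z.avoid A (k + (n + 1)) x := by
          rw [lintegral_add_left .of_discrete, lintegral_const_mul _ .of_discrete,
            lintegral_tsum fun n => Measurable.of_discrete.aemeasurable, ← add_assoc,
            lintegral_add_compl _ .of_discrete]
          simp_rw [← avoid_succ]
          simp [add_assoc]
  have hfin := hpos.tsum_avoid_ne_top hirr hA x₀
  have hlim : Tendsto (fun n => M + K * ∑' k, Z.avoid A (k + n) x₀) atTop (𝓝 (M + K * 0)) :=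
    (ENNReal.Tendsto.const_mul (ENNReal.tendsto_sum_nat_add _ hfin) (Or.inr hK)).const_add _
  rw [mul_zero, add_zero] at hlim
  exact absurd hlt (ge_of_tendsto' hlim fun n => key n x₀ hx₀).not_gt

end MChain

section Taylor

lemma abs_le_mul_abs_sub_pow_succ {H H' : ℝ → ℝ} {K : ℝ} {n : ℕ} (h1 : H 1 = 0)
    (hd : ∀ t ∈ Set.Icc (1 / 2 : ℝ) (3 / 2), HasDerivAt H (H' t) t)
    (hb : ∀ t ∈ Set.Icc (1 / 2 : ℝ) (3 / 2), |H' t| ≤ K * |t - 1| ^ n) {t : ℝ}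
    (ht : t ∈ Set.Icc (1 / 2 : ℝ) (3 / 2)) : |H t| ≤ K * |t - 1| ^ (n + 1) := by
  have hK : 0 ≤ K := by
    have := (abs_nonneg _).trans (hb (1 / 2) (by norm_num))
    have h2 : (0 : ℝ) < |1 / 2 - 1| ^ n := by norm_num
    exact nonneg_of_mul_nonneg_left this h2
  have hsub : Set.uIcc 1 t ⊆ Set.Icc (1 / 2 : ℝ) (3 / 2) :=
    Set.uIcc_subset_Icc (by norm_num) ht
  have := (convex_uIcc (1 : ℝ) t).norm_image_sub_le_of_norm_hasDerivWithin_le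
    (f := H) (f' := H') (C := K * |t - 1| ^ n)
    (fun s hs => (hd s (hsub hs)).hasDerivWithinAt)
    (fun s hs => (hb s (hsub hs)).trans (mul_le_mul_of_nonneg_left
      (pow_le_pow_left₀ (abs_nonneg _) (Set.abs_sub_left_of_mem_uIcc hs) n) hK))
    Set.left_mem_uIcc Set.right_mem_uIcc
  rw [h1, sub_zero, Real.norm_eq_abs, Real.norm_eq_abs] at this
  rwa [pow_succ, ← mul_assoc]

/-- Second order Taylor bound at `1` with remainder of order `2 + ε`, valid on sets `T s` on which
the function is at most of order `s + t²`. -/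
lemma exists_taylor_bound {G G₁ G₂ G₃ : ℝ → ℝ} {T : ℝ → Set ℝ} {ε M : ℝ} (hε : 0 < ε)
    (hε1 : ε ≤ 1)
    (hd₀ : ∀ t ∈ Set.Icc (1 / 2 : ℝ) (3 / 2), HasDerivAt G (G₁ t) t)
    (hd₁ : ∀ t ∈ Set.Icc (1 / 2 : ℝ) (3 / 2), HasDerivAt G₁ (G₂ t) t)
    (hd₂ : ∀ t ∈ Set.Icc (1 / 2 : ℝ) (3 / 2), HasDerivAt G₂ (G₃ t) t)
    (hc : ContinuousOn G₃ (Set.Icc (1 / 2) (3 / 2)))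
    (hM : ∀ s, 1 ≤ s → ∀ t ∈ T s, |G t| ≤ M * (s + t ^ 2)) :
    ∃ K, 0 ≤ K ∧ ∀ s, 1 ≤ s → ∀ t ∈ T s,
      |G t - (G 1 + G₁ 1 * (t - 1) + G₂ 1 / 2 * (t - 1) ^ 2)| ≤ K * s * |t - 1| ^ (2 + ε) := by
  obtain ⟨K₀, hK₀⟩ := isCompact_Icc.exists_bound_of_continuousOn hc
  have hK₀0 : 0 ≤ K₀ := (norm_nonneg _).trans (hK₀ 1 (by norm_num))
  have b2 : ∀ t ∈ Set.Icc (1 / 2 : ℝ) (3 / 2), |G₂ t - G₂ 1| ≤ K₀ * |t - 1| ^ 1 := fun t ht =>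
    abs_le_mul_abs_sub_pow_succ (H := fun t => G₂ t - G₂ 1) (n := 0) (sub_self _)
      (fun t ht => (hd₂ t ht).sub_const _) (fun t ht => by simpa using hK₀ t ht) ht
  have b1 : ∀ t ∈ Set.Icc (1 / 2 : ℝ) (3 / 2),
      |G₁ t - (G₁ 1 + G₂ 1 * (t - 1))| ≤ K₀ * |t - 1| ^ 2 := fun t ht =>
    abs_le_mul_abs_sub_pow_succ (H := fun t => G₁ t - (G₁ 1 + G₂ 1 * (t - 1))) (n := 1) (by simp)
      (fun t ht => ((hd₁ t ht).sub ((((hasDerivAt_id t).sub_const 1).const_mul (G₂ 1)).const_add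
        (G₁ 1))).congr_deriv (by ring)) b2 ht
  have b0 : ∀ t ∈ Set.Icc (1 / 2 : ℝ) (3 / 2),
      |G t - (G 1 + G₁ 1 * (t - 1) + G₂ 1 / 2 * (t - 1) ^ 2)| ≤ K₀ * |t - 1| ^ 3 := fun t ht =>
    abs_le_mul_abs_sub_pow_succ
      (H := fun t => G t - (G 1 + G₁ 1 * (t - 1) + G₂ 1 / 2 * (t - 1) ^ 2)) (n := 2) (by simp)
      (fun t ht => ((hd₀ t ht).sub (((((hasDerivAt_id t).sub_const 1).const_mul (G₁ 1)).const_add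
        (G 1)).add ((((hasDerivAt_id t).sub_const 1).pow 2).const_mul (G₂ 1 / 2)))).congr_deriv
          (by simp; ring)) b1 ht
  let B : ℝ := 16 * (|M| * 10 + |G 1| + |G₁ 1| + |G₂ 1|)
  have hB : 0 ≤ B := by positivity
  refine ⟨K₀ + B, by positivity, fun s hs t ht => ?_⟩
  have hpow0 : 0 ≤ |t - 1| ^ (2 + ε) := by positivity
  by_cases hnear : |t - 1| ≤ 1 / 2
  · have htI : t ∈ Set.Icc (1 / 2 : ℝ) (3 / 2) := by
      have := abs_le.1 hnear
      constructor <;> linarith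
    have h3 : |t - 1| ^ 3 ≤ |t - 1| ^ (2 + ε) := by
      rw [← Real.rpow_natCast]
      rcases (abs_nonneg (t - 1)).eq_or_lt with h0 | h0
      · rw [← h0, Real.zero_rpow (by norm_num), Real.zero_rpow (by positivity)]
      · exact Real.rpow_le_rpow_of_exponent_ge h0 (by linarith) (by push_cast; linarith)
    calc _ ≤ K₀ * |t - 1| ^ 3 := b0 t htI
      _ ≤ K₀ * |t - 1| ^ (2 + ε) := by gcongr
      _ ≤ (K₀ + B) * s * |t - 1| ^ (2 + ε) := by
        gcongr
        nlinarith
  · push Not at hnear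
    set r := |t - 1| with hr
    have hr2 : r ^ 2 ≤ 2 * r ^ (2 + ε) := by
      have h : r ^ (2 + ε) = r ^ 2 * r ^ ε := by
        rw [Real.rpow_add (by linarith), Real.rpow_two]
      have h2 : 1 / 2 ≤ r ^ ε := by
        calc (1 / 2 : ℝ) = (1 / 2) ^ (1 : ℝ) := by simp
          _ ≤ (1 / 2) ^ ε := Real.rpow_le_rpow_of_exponent_ge (by norm_num) (by norm_num) hε1
          _ ≤ r ^ ε := Real.rpow_le_rpow (by norm_num) hnear.le hε.le
      rw [h]
      nlinarith [sq_nonneg r]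
    have hr2' : 1 ≤ 4 * r ^ 2 := by nlinarith
    have hsq : (t - 1) ^ 2 = r ^ 2 := (sq_abs _).symm
    have ht2 : t ^ 2 ≤ 10 * r ^ 2 := by nlinarith [sq_nonneg (t - 2)]
    have hG : |G t| ≤ |M| * (s + t ^ 2) :=
      (hM s hs t ht).trans (mul_le_mul_of_nonneg_right (le_abs_self M) (by positivity))
    have hfin : |G t - (G 1 + G₁ 1 * (t - 1) + G₂ 1 / 2 * (t - 1) ^ 2)|
        ≤ |G t| + |G 1| + |G₁ 1| * r + |G₂ 1| / 2 * r ^ 2 := by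
      have e1 : |G₁ 1 * (t - 1)| = |G₁ 1| * r := abs_mul _ _
      have e2 : |G₂ 1 / 2 * (t - 1) ^ 2| = |G₂ 1| / 2 * r ^ 2 := by
        rw [hsq, abs_mul, abs_div, abs_of_nonneg (sq_nonneg r)]; norm_num
      rw [← e1, ← e2]
      have q1 := abs_sub (G t) (G 1 + G₁ 1 * (t - 1) + G₂ 1 / 2 * (t - 1) ^ 2)
      have q2 := abs_add_le (G 1 + G₁ 1 * (t - 1)) (G₂ 1 / 2 * (t - 1) ^ 2)
      have q3 := abs_add_le (G 1) (G₁ 1 * (t - 1))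
      linarith
    have hBs : |G t| + |G 1| + |G₁ 1| * r + |G₂ 1| / 2 * r ^ 2 ≤ B / 2 * s * r ^ 2 := by
      have k1 : |M| * (s + t ^ 2) ≤ |M| * (14 * (s * r ^ 2)) := by
        gcongr
        nlinarith [sq_nonneg r]
      have hrs : r ^ 2 ≤ s * r ^ 2 := by nlinarith [sq_nonneg r]
      have k2 : |G 1| ≤ |G 1| * (4 * (s * r ^ 2)) := le_mul_of_one_le_right (abs_nonneg _)
        (by nlinarith)
      have k3 : |G₁ 1| * r ≤ |G₁ 1| * (2 * (s * r ^ 2)) := by gcongr; nlinarith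
      have k4 : |G₂ 1| / 2 * r ^ 2 ≤ |G₂ 1| / 2 * (s * r ^ 2) := by gcongr
      have p := mul_nonneg (abs_nonneg M) ((sq_nonneg r).trans hrs)
      have p1 := mul_nonneg (abs_nonneg (G 1)) ((sq_nonneg r).trans hrs)
      have p2 := mul_nonneg (abs_nonneg (G₁ 1)) ((sq_nonneg r).trans hrs)
      have p3 := mul_nonneg (abs_nonneg (G₂ 1)) ((sq_nonneg r).trans hrs)
      have hBe : B / 2 * s * r ^ 2 = 80 * (|M| * (s * r ^ 2)) + 8 * (|G 1| * (s * r ^ 2))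
          + 8 * (|G₁ 1| * (s * r ^ 2)) + 8 * (|G₂ 1| * (s * r ^ 2)) := by simp only [B]; ring
      rw [hBe]
      linarith
    calc _ ≤ B / 2 * s * r ^ 2 := hfin.trans hBs
      _ ≤ B / 2 * s * (2 * r ^ (2 + ε)) := by gcongr
      _ = B * s * r ^ (2 + ε) := by ring
      _ ≤ (K₀ + B) * s * r ^ (2 + ε) := by gcongr; linarith

lemma exists_taylor_bound_rpow {ε α a M : ℝ} (hε : 0 < ε) (hε1 : ε ≤ 1)
    (hM : ∀ s, 1 ≤ s → ∀ t : ℝ, 0 < t → t ^ (-α) ≤ s → t ^ a ≤ M * (s + t ^ 2)) :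
    ∃ K, 0 ≤ K ∧ ∀ s, 1 ≤ s → ∀ t : ℝ, 0 < t → t ^ (-α) ≤ s →
      |t ^ a - (1 + a * (t - 1) + a * (a - 1) / 2 * (t - 1) ^ 2)|
        ≤ K * s * |t - 1| ^ (2 + ε) := by
  have hd (c b : ℝ) : ∀ t ∈ Set.Icc (1 / 2 : ℝ) (3 / 2),
      HasDerivAt (fun t : ℝ => c * t ^ b) (c * b * t ^ (b - 1)) t := fun t ht =>
    ((Real.hasDerivAt_rpow_const (Or.inl (by linarith [ht.1]))).const_mul c).congr_deriv (by ring)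
  obtain ⟨K, hK, h⟩ := exists_taylor_bound (T := fun s => {t | 0 < t ∧ t ^ (-α) ≤ s}) hε hε1
    (hd 1 a) (hd _ _) (hd _ _)
    (fun t ht => ((hd _ _ t ht).continuousAt.continuousWithinAt)) (M := M)
    (fun s hs t ht => by
      rw [one_mul, abs_of_nonneg (Real.rpow_nonneg ht.1.le _)]
      exact hM s hs t ht.1 ht.2)
  refine ⟨K, hK, fun s hs t ht hts => ?_⟩
  simpa using h s hs t ⟨ht, hts⟩

lemma exists_taylor_bound_log {ε α : ℝ} (hε : 0 < ε) (hε1 : ε ≤ 1) (hα : 0 < α) :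
    ∃ K, 0 ≤ K ∧ ∀ s, 1 ≤ s → ∀ t : ℝ, 0 < t → t ^ (-α) ≤ s →
      |Real.log t - ((t - 1) - 1 / 2 * (t - 1) ^ 2)| ≤ K * s * |t - 1| ^ (2 + ε) := by
  have hd (c b : ℝ) : ∀ t ∈ Set.Icc (1 / 2 : ℝ) (3 / 2),
      HasDerivAt (fun t : ℝ => c * t ^ b) (c * b * t ^ (b - 1)) t := fun t ht =>
    ((Real.hasDerivAt_rpow_const (Or.inl (by linarith [ht.1]))).const_mul c).congr_deriv (by ring)
  obtain ⟨K, hK, h⟩ := exists_taylor_bound (T := fun s => {t | 0 < t ∧ t ^ (-α) ≤ s}) hε hε1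
    (G := Real.log)
    (fun t ht => (Real.hasDerivAt_log (by linarith [ht.1])).congr_deriv
      (by rw [one_mul, Real.rpow_neg_one])) (hd 1 (-1)) (hd _ _)
    (fun t ht => ((hd _ _ t ht).continuousAt.continuousWithinAt)) (M := 1 + 1 / α)
    (fun s hs t ht => by
      have h1 : Real.log t ≤ t := Real.log_le_self ht.1.le
      have h2 : -Real.log t ≤ s / α := by
        rw [← Real.log_inv]
        refine (Real.log_le_rpow_div (inv_nonneg.2 ht.1.le) hα).trans ?_
        rw [Real.inv_rpow ht.1.le, ← Real.rpow_neg ht.1.le]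
        gcongr
        exact ht.2
      have h3 : (1 + 1 / α) * (s + t ^ 2) = s + t ^ 2 + s / α + t ^ 2 / α := by ring
      have h4 : 0 ≤ s / α := by positivity
      have h5 : 0 ≤ t ^ 2 / α := by positivity
      rw [h3, abs_le]
      constructor <;> nlinarith)
  refine ⟨K, hK, fun s hs t ht hts => ?_⟩
  convert h s hs t ⟨ht, hts⟩ using 2
  simp
  ring

end Taylor

lemma exists_pos_eventually_le_of_liminf_pos {f : ℕ → ℝ} (h : 0 < atTop.liminf f) :
    ∃ c, 0 < c ∧ ∀ᶠ n in atTop, c ≤ f n := by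
  rw [liminf_eq] at h
  have hne : {a | ∀ᶠ n in atTop, a ≤ f n}.Nonempty := by
    by_contra hne
    rw [Set.not_nonempty_iff_eq_empty.1 hne, Real.sSup_empty] at h
    exact lt_irrefl _ h
  obtain ⟨c, hc, h0⟩ := exists_lt_of_lt_csSup hne h
  exact ⟨c, h0, hc⟩

lemma exists_pos_eventually_le_neg_of_limsup_neg {f : ℕ → ℝ} (h : atTop.limsup f < 0) :
    ∃ c, 0 < c ∧ ∀ᶠ n in atTop, f n ≤ -c := by
  rw [limsup_eq] at h
  have hne : {a | ∀ᶠ n in atTop, f n ≤ a}.Nonempty := by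
    by_contra hne
    rw [Set.not_nonempty_iff_eq_empty.1 hne, Real.sInf_empty] at h
    exact lt_irrefl _ h
  obtain ⟨c, hc, h0⟩ := exists_lt_of_csInf_lt hne h
  exact ⟨-c, by linarith, by simpa using hc⟩

lemma exists_finite_exceptional_set {p : ℕ → Prop} (h : ∀ᶠ z in atTop, p z) :
    ∃ N, ∀ z ∉ Set.Iic N, p z := by
  obtain ⟨N, hN⟩ := eventually_atTop.1 h
  exact ⟨N, fun z hz => hN z (not_le.1 hz).le⟩

lemma tendsto_one_add_rpow_neg {b : ℝ} (hb : b < 0) :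
    Tendsto (fun z : ℕ => (1 + (z : ℝ)) ^ b) atTop (𝓝 0) := by
  have h := tendsto_rpow_neg_atTop (neg_pos.2 hb)
  rw [neg_neg] at h
  exact h.comp (tendsto_const_nhds.add_atTop tendsto_natCast_atTop_atTop)

namespace MChain

variable {Z : MChain ℕ}

lemma natMoment_eq (k z : ℕ) : natMoment Z k z = ∫ w : ℕ, ((w : ℝ) - z) ^ k ∂Z.step z :=
  (Z.integral_step z fun w => ((w : ℝ) - z) ^ k).symm

lemma lintegral_ofReal_step {g : ℕ → ℝ} {z : ℕ} (hg : Integrable g (Z.step z))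
    (h0 : ∀ w, 0 ≤ g w) :
    ∫⁻ w, ENNReal.ofReal (g w) ∂Z.step z = ENNReal.ofReal (∫ w, g w ∂Z.step z) :=
  (ofReal_integral_eq_lintegral_ofReal hg (Eventually.of_forall h0)).symm

lemma abs_natCast_sub_eq_zero_or (w z : ℕ) : |(w : ℝ) - z| = 0 ∨ 1 ≤ |(w : ℝ) - z| := by
  rcases eq_or_ne (w : ℤ) z with h | h
  · left
    have : (w : ℝ) = z := by exact_mod_cast h
    rw [this, sub_self, abs_zero]
  · right
    have : 1 ≤ |(w : ℤ) - z| := Int.one_le_abs (sub_ne_zero.2 h)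
    exact_mod_cast this

lemma abs_natCast_sub_rpow_le (w z : ℕ) {a b : ℝ} (ha : 0 < a) (hab : a ≤ b) :
    |(w : ℝ) - z| ^ a ≤ |(w : ℝ) - z| ^ b := by
  rcases abs_natCast_sub_eq_zero_or w z with h | h
  · rw [h, Real.zero_rpow ha.ne', Real.zero_rpow (ha.trans_le hab).ne']
  · exact Real.rpow_le_rpow_of_exponent_le h hab

/-- The jumps of the chain have `(2 + ε)`-th moments bounded by `C`. -/
def MomentBound (Z : MChain ℕ) (ε C : ℝ) : Prop :=
  ∀ z : ℕ, Integrable (fun w : ℕ => |(w : ℝ) - z| ^ (2 + ε)) (Z.step z) ∧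
    ∫ w : ℕ, |(w : ℝ) - z| ^ (2 + ε) ∂Z.step z ≤ C

lemma exists_momentBound
    (hmom : ∃ ε : ℝ, 0 < ε ∧ ∃ C : ℝ≥0∞, C ≠ ⊤ ∧ ∀ z : ℕ,
      (∫⁻ ω, ENNReal.ofReal (|(ω 1 : ℝ) - (z : ℝ)| ^ (2 + ε)) ∂(Z.P z)) ≤ C) :
    ∃ ε C : ℝ, 0 < ε ∧ ε ≤ 1 ∧ 0 ≤ C ∧ Z.MomentBound ε C := by
  obtain ⟨ε, hε, C, hC, h⟩ := hmom
  refine ⟨min ε 1, C.toReal, lt_min hε one_pos, min_le_right _ _, ENNReal.toReal_nonneg,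
    fun z => ?_⟩
  have h0 : 0 < min ε 1 := lt_min hε one_pos
  have hle : ∫⁻ w : ℕ, ENNReal.ofReal (|(w : ℝ) - z| ^ (2 + min ε 1)) ∂Z.step z ≤ C := by
    refine le_trans (lintegral_mono fun w => ENNReal.ofReal_le_ofReal ?_)
      ((Z.lintegral_step z fun w => ENNReal.ofReal (|(w : ℝ) - z| ^ (2 + ε))).trans_le (h z))
    exact abs_natCast_sub_rpow_le w z (by linarith) (by linarith [min_le_left ε 1])
  have hnn : ∀ w : ℕ, 0 ≤ |(w : ℝ) - z| ^ (2 + min ε 1) := fun w => by positivity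
  have hint : Integrable (fun w : ℕ => |(w : ℝ) - z| ^ (2 + min ε 1)) (Z.step z) :=
    (lintegral_ofReal_ne_top_iff_integrable Measurable.of_discrete.aestronglyMeasurable
      (Eventually.of_forall hnn)).1 (ne_top_of_le_ne_top hC hle)
  refine ⟨hint, ?_⟩
  rw [lintegral_ofReal_step hint hnn] at hle
  exact (ENNReal.ofReal_le_iff_le_toReal hC).1 hle

namespace MomentBound

variable {ε C : ℝ}

lemma sq_le (hε : 0 < ε) (w z : ℕ) : ((w : ℝ) - z) ^ 2 ≤ |(w : ℝ) - z| ^ (2 + ε) := by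
  rw [← sq_abs, ← Real.rpow_two]
  exact abs_natCast_sub_rpow_le w z two_pos (by linarith)

lemma integrable_sq (hm : Z.MomentBound ε C) (hε : 0 < ε) (z : ℕ) :
    Integrable (fun w : ℕ => ((w : ℝ) - z) ^ 2) (Z.step z) :=
  (hm z).1.mono' Measurable.of_discrete.aestronglyMeasurable
    (Eventually.of_forall fun w => by
      rw [Real.norm_of_nonneg (sq_nonneg _)]
      exact sq_le hε w z)

lemma integrable_sub (hm : Z.MomentBound ε C) (hε : 0 < ε) (z : ℕ) :
    Integrable (fun w : ℕ => (w : ℝ) - z) (Z.step z) :=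
  (hm.integrable_sq hε z).mono' Measurable.of_discrete.aestronglyMeasurable
    (Eventually.of_forall fun w => by
      rw [Real.norm_eq_abs, ← sq_abs]
      rcases abs_natCast_sub_eq_zero_or w z with h | h
      · rw [h]; norm_num
      · nlinarith)

lemma natMoment_two_le (hm : Z.MomentBound ε C) (hε : 0 < ε) (z : ℕ) :
    natMoment Z 2 z ≤ C := by
  rw [natMoment_eq]
  exact (integral_mono (hm.integrable_sq hε z) (hm z).1 fun w => sq_le hε w z).trans (hm z).2

lemma natMoment_two_nonneg (z : ℕ) : 0 ≤ natMoment Z 2 z :=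
  integral_nonneg fun _ => sq_nonneg _

lemma integral_quadratic (hm : Z.MomentBound ε C) (hε : 0 < ε) (z : ℕ) (c₀ c₁ c₂ : ℝ) :
    Integrable (fun w : ℕ => c₀ + c₁ * ((w : ℝ) - z) + c₂ * ((w : ℝ) - z) ^ 2) (Z.step z) ∧
    ∫ w : ℕ, (c₀ + c₁ * ((w : ℝ) - z) + c₂ * ((w : ℝ) - z) ^ 2) ∂Z.step z
      = c₀ + c₁ * natMoment Z 1 z + c₂ * natMoment Z 2 z := by
  have h1 := (hm.integrable_sub hε z).const_mul c₁
  have h2 := (hm.integrable_sq hε z).const_mul c₂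
  have h01 : Integrable (fun w : ℕ => c₀ + c₁ * ((w : ℝ) - z)) (Z.step z) :=
    (integrable_const _).add h1
  refine ⟨h01.add h2, ?_⟩
  rw [integral_add h01 h2, integral_add (integrable_const _) h1, integral_const_mul,
    integral_const_mul, natMoment_eq, natMoment_eq]
  simp

/-- Expansion of the mean of a function of the rescaled position after one step. -/
lemma integral_rescaled (hm : Z.MomentBound ε C) (hε : 0 < ε) {α K c₀ c₁ c₂ : ℝ} (hα : 0 < α)
    (hK : 0 ≤ K) {G : ℝ → ℝ}
    (hG : ∀ s, 1 ≤ s → ∀ t : ℝ, 0 < t → t ^ (-α) ≤ s →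
      |G t - (c₀ + c₁ * (t - 1) + c₂ * (t - 1) ^ 2)| ≤ K * s * |t - 1| ^ (2 + ε)) (z : ℕ) :
    Integrable (fun w : ℕ => G ((1 + w) / (1 + z))) (Z.step z) ∧
    |∫ w : ℕ, G ((1 + w) / (1 + z)) ∂Z.step z
        - (c₀ + c₁ * (natMoment Z 1 z / (1 + z)) + c₂ * (natMoment Z 2 z / (1 + z) ^ 2))|
      ≤ K * C * (1 + (z : ℝ)) ^ (α - ε) / (1 + z) ^ 2 := by
  set y : ℝ := 1 + z with hy
  have hy1 : 1 ≤ y := by simp [hy]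
  have hy0 : 0 < y := by linarith
  have ht1 (w : ℕ) : (1 + (w : ℝ)) / y - 1 = (w - z) / y := by
    rw [hy]; field_simp; ring
  have hyp : y ^ α * (y ^ (2 + ε))⁻¹ = y ^ (α - ε) / y ^ 2 := by
    rw [← Real.rpow_neg hy0.le, ← Real.rpow_add hy0, ← Real.rpow_two, ← Real.rpow_sub hy0]
    congr 1; ring
  let q : ℕ → ℝ := fun w => c₀ + c₁ / y * ((w : ℝ) - z) + c₂ / y ^ 2 * ((w : ℝ) - z) ^ 2
  obtain ⟨hqi, hq⟩ := hm.integral_quadratic hε z c₀ (c₁ / y) (c₂ / y ^ 2)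
  have hpt (w : ℕ) : |G ((1 + w) / y) - q w|
      ≤ K * (y ^ (α - ε) / y ^ 2) * |(w : ℝ) - z| ^ (2 + ε) := by
    have hw0 : (0 : ℝ) < 1 + w := by positivity
    have h := hG (y ^ α) (Real.one_le_rpow hy1 hα.le) ((1 + w) / y) (by positivity) (by
      rw [Real.rpow_neg (by positivity), Real.div_rpow hw0.le hy0.le, inv_div]
      exact div_le_self (by positivity) (Real.one_le_rpow (by simp) hα.le))
    rw [ht1, abs_div, abs_of_pos hy0, Real.div_rpow (abs_nonneg _) hy0.le] at h
    calc _ = |G ((1 + w) / y)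
            - (c₀ + c₁ * (((w : ℝ) - z) / y) + c₂ * (((w : ℝ) - z) / y) ^ 2)| := by
          have hqw : q w = c₀ + c₁ * (((w : ℝ) - z) / y) + c₂ * (((w : ℝ) - z) / y) ^ 2 := by
            simp only [q]
            field_simp
          rw [hqw]
      _ ≤ K * y ^ α * (|(w : ℝ) - z| ^ (2 + ε) / y ^ (2 + ε)) := h
      _ = K * (y ^ α * (y ^ (2 + ε))⁻¹) * |(w : ℝ) - z| ^ (2 + ε) := by ring
      _ = _ := by rw [hyp]
  have hdom := (hm z).1.const_mul (K * (y ^ (α - ε) / y ^ 2))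
  have hdi : Integrable (fun w : ℕ => G ((1 + w) / y) - q w) (Z.step z) :=
    hdom.mono' Measurable.of_discrete.aestronglyMeasurable (Eventually.of_forall hpt)
  have hGi : Integrable (fun w : ℕ => G ((1 + w) / y)) (Z.step z) := by
    refine (hdi.add hqi).congr (Eventually.of_forall fun w => ?_)
    simp only [Pi.add_apply, q, sub_add_cancel]
  refine ⟨hGi, ?_⟩
  have hval : c₀ + c₁ * (natMoment Z 1 z / y) + c₂ * (natMoment Z 2 z / y ^ 2)
      = ∫ w, q w ∂Z.step z := by
    rw [hq]; ring
  rw [hval, ← integral_sub hGi hqi]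
  calc _ ≤ ∫ w : ℕ, |G ((1 + w) / y) - q w| ∂Z.step z := abs_integral_le_integral_abs
    _ ≤ ∫ w : ℕ, K * (y ^ (α - ε) / y ^ 2) * |(w : ℝ) - z| ^ (2 + ε) ∂Z.step z :=
      integral_mono hdi.abs hdom hpt
    _ ≤ K * (y ^ (α - ε) / y ^ 2) * C := by
      rw [integral_const_mul]
      exact mul_le_mul_of_nonneg_left (hm z).2 (by positivity)
    _ = _ := by ring

lemma integral_rpow (hm : Z.MomentBound ε C) (hε : 0 < ε) (hε1 : ε ≤ 1) {α a : ℝ} (hα : 0 < α)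
    (ha : ∀ s, 1 ≤ s → ∀ t : ℝ, 0 < t → t ^ (-α) ≤ s → t ^ a ≤ 1 * (s + t ^ 2)) :
    ∃ K, 0 ≤ K ∧ ∀ z : ℕ,
      Integrable (fun w : ℕ => ((1 + w : ℝ) / (1 + z)) ^ a) (Z.step z) ∧
      |∫ w : ℕ, ((1 + w : ℝ) / (1 + z)) ^ a ∂Z.step z
        - (1 + a * (natMoment Z 1 z / (1 + z)) + a * (a - 1) / 2 * (natMoment Z 2 z / (1 + z) ^ 2))|
      ≤ K * C * (1 + (z : ℝ)) ^ (α - ε) / (1 + z) ^ 2 := by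
  obtain ⟨K, hK, h⟩ := exists_taylor_bound_rpow hε hε1 ha
  exact ⟨K, hK, fun z => hm.integral_rescaled hε hα hK h z⟩

lemma integral_rpow_neg (hm : Z.MomentBound ε C) (hε : 0 < ε) (hε1 : ε ≤ 1) {α : ℝ} (hα : 0 < α) :
    ∃ K, 0 ≤ K ∧ ∀ z : ℕ,
      Integrable (fun w : ℕ => ((1 + w : ℝ) / (1 + z)) ^ (-α)) (Z.step z) ∧
      |∫ w : ℕ, ((1 + w : ℝ) / (1 + z)) ^ (-α) ∂Z.step z
        - (1 - α * (natMoment Z 1 z / (1 + z))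
          + α * (α + 1) / 2 * (natMoment Z 2 z / (1 + z) ^ 2))|
      ≤ K * C * (1 + (z : ℝ)) ^ (α - ε) / (1 + z) ^ 2 := by
  obtain ⟨K, hK, h⟩ := hm.integral_rpow hε hε1 (a := -α) hα
    fun s _ t _ hts => by nlinarith [sq_nonneg t]
  refine ⟨K, hK, fun z => ⟨(h z).1, ?_⟩⟩
  convert (h z).2 using 3
  ring

lemma integral_rpow_two_sub (hm : Z.MomentBound ε C) (hε : 0 < ε) (hε1 : ε ≤ 1) {α : ℝ}
    (hα : 0 < α) (hα2 : α ≤ 2) :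
    ∃ K, 0 ≤ K ∧ ∀ z : ℕ,
      Integrable (fun w : ℕ => ((1 + w : ℝ) / (1 + z)) ^ (2 - α)) (Z.step z) ∧
      |∫ w : ℕ, ((1 + w : ℝ) / (1 + z)) ^ (2 - α) ∂Z.step z
        - (1 + (2 - α) * (natMoment Z 1 z / (1 + z))
          + (2 - α) * (1 - α) / 2 * (natMoment Z 2 z / (1 + z) ^ 2))|
      ≤ K * C * (1 + (z : ℝ)) ^ (α - ε) / (1 + z) ^ 2 := by
  obtain ⟨K, hK, h⟩ := hm.integral_rpow hε hε1 (a := 2 - α) hα fun s hs t ht hts => by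
    rcases le_total t 1 with h | h
    · have := Real.rpow_le_one ht.le h (by linarith : 0 ≤ 2 - α)
      nlinarith [sq_nonneg t]
    · have := Real.rpow_le_rpow_of_exponent_le h (by linarith : 2 - α ≤ 2)
      rw [Real.rpow_two] at this
      linarith
  refine ⟨K, hK, fun z => ⟨(h z).1, ?_⟩⟩
  convert (h z).2 using 3
  ring

lemma integral_log (hm : Z.MomentBound ε C) (hε : 0 < ε) (hε1 : ε ≤ 1) {α : ℝ} (hα : 0 < α) :
    ∃ K, 0 ≤ K ∧ ∀ z : ℕ,
      Integrable (fun w : ℕ => Real.log ((1 + w : ℝ) / (1 + z))) (Z.step z) ∧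
      |∫ w : ℕ, Real.log ((1 + w : ℝ) / (1 + z)) ∂Z.step z
        - (natMoment Z 1 z / (1 + z) - 1 / 2 * (natMoment Z 2 z / (1 + z) ^ 2))|
      ≤ K * C * (1 + (z : ℝ)) ^ (α - ε) / (1 + z) ^ 2 := by
  obtain ⟨K, hK, h⟩ := exists_taylor_bound_log hε hε1 hα
  have h' := hm.integral_rescaled hε (c₀ := 0) (c₁ := 1) (c₂ := -(1 / 2)) (G := Real.log) hα hK
    fun s hs t ht hts => by
      convert h s hs t ht hts using 3
      ring
  refine ⟨K, hK, fun z => ⟨(h' z).1, ?_⟩⟩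
  convert (h' z).2 using 3
  ring

end MomentBound

lemma eventually_mul_rpow_le (a : ℝ) {b c : ℝ} (hb : b < 0) (hc : 0 < c) :
    ∀ᶠ z : ℕ in atTop, a * (1 + (z : ℝ)) ^ b ≤ c := by
  have h := (tendsto_one_add_rpow_neg hb).const_mul a
  rw [mul_zero] at h
  exact h.eventually (eventually_le_nhds hc)

/-- Factoring powers of the current position out of powers of the next one. -/
lemma one_add_rpow_eq (w z : ℕ) (a : ℝ) :
    (1 + (w : ℝ)) ^ a = (1 + (z : ℝ)) ^ a * ((1 + (w : ℝ)) / (1 + z)) ^ a := by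
  rw [← Real.mul_rpow (by positivity) (by positivity)]
  congr 1
  field_simp

lemma MomentBound.transient (hirr : Z.Irreducible) {ε C : ℝ} (hm : Z.MomentBound ε C) (hε : 0 < ε)
    (hε1 : ε ≤ 1) (hC : 0 ≤ C) {c : ℝ} (hc : 0 < c)
    (h : ∀ᶠ z : ℕ in atTop, c ≤ 2 * (z : ℝ) * natMoment Z 1 z - natMoment Z 2 z) :
    Z.Transient := by
  set α := min (ε / 2) (c / (2 * (C + 1)))
  have hα : 0 < α := lt_min (by positivity) (by positivity)
  have hαε : α ≤ ε / 2 := min_le_left _ _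
  have hαC : α * (C + 1) ≤ c / 2 := by
    calc α * (C + 1) ≤ c / (2 * (C + 1)) * (C + 1) := by gcongr; exact min_le_right _ _
      _ = c / 2 := by field_simp
  obtain ⟨K, -, hK⟩ := hm.integral_rpow_neg hε hε1 hα
  obtain ⟨N, hN⟩ := exists_finite_exceptional_set (h.and ((eventually_ge_atTop 1).and
    (eventually_mul_rpow_le (K * C) (b := α - ε) (by linarith)
      (show 0 < α * c / 4 by positivity))))
  have hanti {u v : ℕ} (huv : u ≤ v) : (1 + (v : ℝ)) ^ (-α) ≤ (1 + (u : ℝ)) ^ (-α) :=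
    Real.rpow_le_rpow_of_nonpos (by positivity) (by gcongr) (by linarith)
  refine Z.transient_of_superharmonic hirr (A := Set.Iic N) ⟨N, Set.self_mem_Iic⟩
    (f := fun w => ENNReal.ofReal ((1 + (w : ℝ)) ^ (-α)))
    (m := ENNReal.ofReal ((1 + (N : ℝ)) ^ (-α)))
    ENNReal.ofReal_ne_top (fun a ha => ENNReal.ofReal_le_ofReal (hanti ha)) (fun z hz => ?_)
    (x₀ := N + 1) (by simp) ?_
  · obtain ⟨h1, hz1, h2⟩ := hN z hz
    obtain ⟨hint, hexp⟩ := hK z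
    have hz1' : (1 : ℝ) ≤ z := by exact_mod_cast hz1
    have hm2 := hm.natMoment_two_le hε z
    have hm20 := natMoment_two_nonneg (Z := Z) z
    set y : ℝ := 1 + z with hy
    have hy0 : 0 < y := by positivity
    have hfac (w : ℕ) : (1 + (w : ℝ)) ^ (-α) = y ^ (-α) * ((1 + w) / y) ^ (-α) :=
      one_add_rpow_eq w z (-α)
    have hmean : ∫ w : ℕ, ((1 + (w : ℝ)) / y) ^ (-α) ∂Z.step z ≤ 1 := by
      have hμ : 0 ≤ natMoment Z 1 z := by
        by_contra hneg
        push Not at hneg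
        nlinarith
      have hkey : -α * (y * natMoment Z 1 z) + α * (α + 1) / 2 * natMoment Z 2 z
          + K * C * y ^ (α - ε) ≤ 0 := by
        have a1 : α * (2 * z * natMoment Z 1 z - natMoment Z 2 z) ≥ α * c := by gcongr
        have a2 : α * natMoment Z 1 z ≥ 0 := by positivity
        have a3 : α * (α * natMoment Z 2 z) ≤ α * (c / 2) := by
          gcongr
          nlinarith
        rw [hy] at h2 ⊢
        nlinarith
      have hdiv := div_nonpos_of_nonpos_of_nonneg hkey (sq_nonneg y)
      have hrew : (-α * (y * natMoment Z 1 z) + α * (α + 1) / 2 * natMoment Z 2 z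
          + K * C * y ^ (α - ε)) / y ^ 2 = -(α * (natMoment Z 1 z / y))
            + α * (α + 1) / 2 * (natMoment Z 2 z / y ^ 2) + K * C * y ^ (α - ε) / y ^ 2 := by
        field_simp
      linarith [(abs_le.1 hexp).2]
    simp only [hfac]
    rw [lintegral_ofReal_step (hint.const_mul _) fun w => by positivity, integral_const_mul]
    refine ENNReal.ofReal_le_ofReal ?_
    exact mul_le_of_le_one_right (by positivity) hmean
  · refine (ENNReal.ofReal_lt_ofReal_iff (by positivity)).2 ?_
    exact Real.rpow_lt_rpow_of_neg (by positivity) (by push_cast; linarith) (by linarith)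

lemma MomentBound.positiveRecurrent (hirr : Z.Irreducible) {ε C : ℝ} (hm : Z.MomentBound ε C)
    (hε : 0 < ε) {c : ℝ} (hc : 0 < c)
    (h : ∀ᶠ z : ℕ in atTop, 2 * (z : ℝ) * natMoment Z 1 z + natMoment Z 2 z ≤ -c) :
    Z.PositiveRecurrent := by
  obtain ⟨N, hN⟩ := exists_finite_exceptional_set h
  have hsq (z : ℕ) : Integrable (fun w : ℕ => (w : ℝ) ^ 2) (Z.step z) ∧
      ∫ w : ℕ, (w : ℝ) ^ 2 ∂Z.step z
        = z ^ 2 + (2 * (z : ℝ) * natMoment Z 1 z + natMoment Z 2 z) := by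
    have hq := hm.integral_quadratic hε z (z ^ 2) (2 * z) 1
    have e : (fun w : ℕ => (w : ℝ) ^ 2)
        = fun w : ℕ => (z : ℝ) ^ 2 + 2 * z * (w - z) + 1 * ((w : ℝ) - z) ^ 2 := by
      ext w
      ring
    rw [e]
    exact ⟨hq.1, hq.2.trans (by ring)⟩
  have hrec : Z.Recurrent := Z.recurrent_of_superharmonic hirr (A := Set.Iic N)
    ⟨N, Set.self_mem_Iic⟩ (Set.finite_Iic N) (f := fun w => (w : ℝ) ^ 2) (fun w => sq_nonneg _)
    ((tendsto_pow_atTop two_ne_zero).comp tendsto_natCast_atTop_atTop)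
    fun z hz => ⟨(hsq z).1, by rw [(hsq z).2]; linarith [hN z hz]⟩
  have hlin (z : ℕ) : ∫⁻ w : ℕ, ENNReal.ofReal ((w : ℝ) ^ 2 / c) ∂Z.step z
      = ENNReal.ofReal ((z ^ 2 + (2 * (z : ℝ) * natMoment Z 1 z + natMoment Z 2 z)) / c) := by
    rw [lintegral_ofReal_step ((hsq z).1.div_const c) fun w => by positivity, integral_div,
      (hsq z).2]
  refine hrec.positiveRecurrent_of_drift hirr (Set.finite_Iic N)
    (f := fun w => ENNReal.ofReal ((w : ℝ) ^ 2 / c)) (fun z => ?_) fun z hz => ?_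
  · rw [hlin]
    exact ENNReal.ofReal_ne_top
  · have hpos : 0 ≤ (z ^ 2 + (2 * (z : ℝ) * natMoment Z 1 z + natMoment Z 2 z)) / c := by
      rw [← (hsq z).2]
      exact div_nonneg (integral_nonneg fun w => sq_nonneg _) hc.le
    rw [hlin, ← ENNReal.ofReal_one, ← ENNReal.ofReal_add hpos zero_le_one]
    refine ENNReal.ofReal_le_ofReal ?_
    rw [div_add_one hc.ne']
    gcongr
    linarith [hN z hz]

/-- The borderline drift condition, restated in terms of `1 + z`. -/
lemma MomentBound.exists_drift_bound {ε C : ℝ} (hm : Z.MomentBound ε C) (hε : 0 < ε)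
    (hC : 0 ≤ C) {δ D : ℝ} (hδ : 0 < δ)
    (h : ∀ᶠ z : ℕ in atTop,
      |2 * (z : ℝ) * natMoment Z 1 z| ≤ natMoment Z 2 z + D * (z : ℝ) ^ (-δ)) :
    ∃ δ' D' : ℝ, 0 < δ' ∧ 0 ≤ D' ∧ ∀ᶠ z : ℕ in atTop,
      |2 * (1 + (z : ℝ)) * natMoment Z 1 z| ≤ natMoment Z 2 z + D' * (1 + (z : ℝ)) ^ (-δ') := by
  refine ⟨min δ 1, 2 * (2 * |D| + C), lt_min hδ one_pos, by positivity, ?_⟩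
  filter_upwards [h, eventually_ge_atTop 1] with z hz hz1
  have hz1' : (1 : ℝ) ≤ z := by exact_mod_cast hz1
  have hm2 := hm.natMoment_two_le hε z
  have hδ0 : 0 < min δ 1 := lt_min hδ one_pos
  set r : ℝ := (z : ℝ) ^ (-min δ 1) with hr
  have hr0 : 0 ≤ r := by positivity
  have hr1 : (z : ℝ) ^ (-δ) ≤ r := Real.rpow_le_rpow_of_exponent_le hz1'
    (neg_le_neg (min_le_left _ _))
  have hr2 : (z : ℝ)⁻¹ ≤ r := by
    rw [← Real.rpow_neg_one]
    exact Real.rpow_le_rpow_of_exponent_le hz1' (neg_le_neg (min_le_right _ _))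
  have hr3 : r ≤ 2 * (1 + (z : ℝ)) ^ (-min δ 1) := by
    have h2 : (2 : ℝ) ^ min δ 1 ≤ 2 := by
      simpa using Real.rpow_le_rpow_of_exponent_le one_le_two (min_le_right δ 1)
    calc r ≤ ((1 + (z : ℝ)) / 2) ^ (-min δ 1) :=
          Real.rpow_le_rpow_of_nonpos (by positivity) (by linarith) (by linarith)
      _ = 2 ^ min δ 1 * (1 + (z : ℝ)) ^ (-min δ 1) := by
        rw [Real.div_rpow (by positivity) (by positivity), Real.rpow_neg zero_le_two,
          div_inv_eq_mul, mul_comm]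
      _ ≤ _ := by gcongr
  have hD : D * (z : ℝ) ^ (-δ) ≤ |D| * r :=
    mul_le_mul (le_abs_self D) hr1 (by positivity) (abs_nonneg D)
  have hz' : |2 * (z : ℝ) * natMoment Z 1 z| ≤ natMoment Z 2 z + |D| * r := hz.trans (by linarith)
  have hrle : r ≤ 1 := Real.rpow_le_one_of_one_le_of_nonpos hz1' (by linarith)
  have hone : |2 * natMoment Z 1 z| ≤ (C + |D|) * r := by
    have e : |2 * natMoment Z 1 z| = (z : ℝ)⁻¹ * |2 * (z : ℝ) * natMoment Z 1 z| := by
      rw [← abs_of_nonneg (show (0 : ℝ) ≤ (z : ℝ)⁻¹ by positivity), ← abs_mul]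
      congr 1
      field_simp
    rw [e, mul_comm]
    refine mul_le_mul ?_ hr2 (by positivity) (by positivity)
    nlinarith [abs_nonneg D]
  have htri : |2 * (1 + (z : ℝ)) * natMoment Z 1 z|
      ≤ |2 * natMoment Z 1 z| + |2 * (z : ℝ) * natMoment Z 1 z| := by
    refine le_trans (le_of_eq ?_) (abs_add_le _ _)
    congr 1
    ring
  calc _ ≤ natMoment Z 2 z + (2 * |D| + C) * r := by linarith
    _ ≤ natMoment Z 2 z + (2 * |D| + C) * (2 * (1 + (z : ℝ)) ^ (-min δ 1)) := by gcongr
    _ = _ := by ring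

lemma MomentBound.recurrent (hirr : Z.Irreducible) {ε C : ℝ} (hm : Z.MomentBound ε C) (hε : 0 < ε)
    (hε1 : ε ≤ 1) {v δ D : ℝ} (hv : 0 < v) (hδ : 0 < δ) (hD : 0 ≤ D)
    (hvar : ∀ᶠ z : ℕ in atTop, v ≤ natMoment Z 2 z)
    (h : ∀ᶠ z : ℕ in atTop,
      |2 * (1 + (z : ℝ)) * natMoment Z 1 z| ≤ natMoment Z 2 z + D * (1 + (z : ℝ)) ^ (-δ)) :
    Z.Recurrent := by
  set α := min ε δ / 4 with hαdef
  have hα : 0 < α := by positivity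
  have hαε : 4 * α ≤ ε := by linarith [min_le_left ε δ]
  have hαδ : 4 * α ≤ δ := by linarith [min_le_right ε δ]
  obtain ⟨K₁, -, hK₁⟩ := hm.integral_log hε hε1 hα
  obtain ⟨K₂, hK₂0, hK₂⟩ := hm.integral_rpow_neg hε hε1 hα
  have hC : 0 ≤ C := natMoment_two_nonneg (Z := Z) 0 |>.trans (hm.natMoment_two_le hε 0)
  obtain ⟨N, hN⟩ := exists_finite_exceptional_set (h.and (hvar.and
    ((eventually_mul_rpow_le (2 * D) (b := α - δ) (by linarith)
      (show 0 < α ^ 2 * v / 2 by positivity)).and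
    (eventually_mul_rpow_le (2 * (K₁ + K₂) * C) (b := 2 * α - ε) (by linarith)
      (show 0 < α ^ 2 * v / 2 by positivity)))))
  have hle1 (w : ℕ) : (1 + (w : ℝ)) ^ (-α) ≤ 1 :=
    Real.rpow_le_one_of_one_le_of_nonpos (by simp) (by linarith)
  have hlog : Tendsto (fun w : ℕ => Real.log (1 + (w : ℝ))) atTop atTop :=
    Real.tendsto_log_atTop.comp (tendsto_atTop_add_const_left _ _ tendsto_natCast_atTop_atTop)
  refine Z.recurrent_of_superharmonic hirr (A := Set.Iic N) ⟨N, Set.self_mem_Iic⟩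
    (Set.finite_Iic N) (f := fun w => Real.log (1 + (w : ℝ)) + (1 - (1 + (w : ℝ)) ^ (-α)))
    (fun w => add_nonneg (Real.log_nonneg (by simp)) (sub_nonneg.2 (hle1 w)))
    (tendsto_atTop_mono (fun w => le_add_of_nonneg_right (sub_nonneg.2 (hle1 w))) hlog)
    fun z hz => ?_
  obtain ⟨hμ, hv2, e1, e2⟩ := hN z hz
  obtain ⟨i1, b1⟩ := hK₁ z
  obtain ⟨i2, b2⟩ := hK₂ z
  have hs1 := hle1 z
  set y : ℝ := 1 + z with hy
  have hy0 : 0 < y := by positivity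
  set s := y ^ (-α) with hs
  have hs0 : 0 < s := by positivity
  have hfac : (fun w : ℕ => Real.log (1 + (w : ℝ)) + (1 - (1 + (w : ℝ)) ^ (-α)))
      = fun w : ℕ => Real.log ((1 + (w : ℝ)) / y) + (Real.log y + 1)
        - s * ((1 + (w : ℝ)) / y) ^ (-α) := by
    ext w
    rw [one_add_rpow_eq w z, Real.log_div (by positivity) hy0.ne']
    ring
  have i3 : Integrable (fun w : ℕ => Real.log ((1 + (w : ℝ)) / y) + (Real.log y + 1)) (Z.step z) :=
    i1.add (integrable_const _)
  rw [hfac]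
  refine ⟨i3.sub (i2.const_mul s), ?_⟩
  rw [integral_sub i3 (i2.const_mul s), integral_add i1 (integrable_const _), integral_const_mul]
  simp only [integral_const, probReal_univ, one_smul]
  set I₁ := ∫ w : ℕ, Real.log ((1 + (w : ℝ)) / y) ∂Z.step z
  set I₂ := ∫ w : ℕ, ((1 + (w : ℝ)) / y) ^ (-α) ∂Z.step z
  suffices hsuff : I₁ - s * (I₂ - 1) ≤ 0 by linarith
  have hP : y ^ (-δ) = s * y ^ (α - δ) := by
    rw [hs, ← Real.rpow_add hy0]; congr 1; ring
  have hQ : y ^ (α - ε) = s * y ^ (2 * α - ε) := by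
    rw [hs, ← Real.rpow_add hy0]; congr 1; ring
  set m₁ := natMoment Z 1 z
  set m₂ := natMoment Z 2 z
  have hb : I₁ - s * (I₂ - 1) ≤ ((2 * y * m₁ - m₂) * (1 + s * α) - s * α ^ 2 * m₂
      + 2 * (K₁ + s * K₂) * C * y ^ (α - ε)) / (2 * y ^ 2) := by
    have u1 := (abs_le.1 b1).2
    have u2 := mul_le_mul_of_nonneg_left (neg_le_of_abs_le b2) hs0.le
    have e : ((2 * y * m₁ - m₂) * (1 + s * α) - s * α ^ 2 * m₂
      + 2 * (K₁ + s * K₂) * C * y ^ (α - ε)) / (2 * y ^ 2)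
        = (m₁ / y - 1 / 2 * (m₂ / y ^ 2)) + K₁ * C * y ^ (α - ε) / y ^ 2
          - s * (-α * (m₁ / y) + α * (α + 1) / 2 * (m₂ / y ^ 2)
            - K₂ * C * y ^ (α - ε) / y ^ 2) := by
      field_simp
      ring
    rw [e]
    linarith
  refine hb.trans (div_nonpos_of_nonpos_of_nonneg ?_ (by positivity))
  have hα1 : α ≤ 1 := by linarith
  have hsα : s * α ≤ 1 := by nlinarith
  have hR : 0 ≤ D * y ^ (-δ) := by positivity
  have c1 : (2 * y * m₁ - m₂) * (1 + s * α) ≤ 2 * (D * y ^ (-δ)) := by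
    have : 2 * y * m₁ - m₂ ≤ D * y ^ (-δ) := by linarith [(abs_le.1 hμ).2]
    calc _ ≤ (D * y ^ (-δ)) * (1 + s * α) := by gcongr
      _ ≤ (D * y ^ (-δ)) * 2 := by gcongr; linarith
      _ = _ := mul_comm _ _
  have c2 : 2 * (K₁ + s * K₂) * C * y ^ (α - ε) ≤ 2 * (K₁ + K₂) * C * y ^ (α - ε) := by
    gcongr
    exact mul_le_of_le_one_left hK₂0 hs1
  have c3 : s * α ^ 2 * v ≤ s * α ^ 2 * m₂ := by gcongr
  have c4 := mul_le_mul_of_nonneg_left e1 hs0.le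
  have c5 := mul_le_mul_of_nonneg_left e2 hs0.le
  have k1 : 2 * (D * y ^ (-δ)) = s * (2 * D * y ^ (α - δ)) := by rw [hP]; ring
  have k2 : 2 * (K₁ + K₂) * C * y ^ (α - ε) = s * (2 * (K₁ + K₂) * C * y ^ (2 * α - ε)) := by
    rw [hQ]; ring
  rw [k2] at c2
  rw [k1] at c1
  linarith

lemma truncatedSq_taylor (z w : ℝ) {R : ℝ} (hR : 0 < R) :
    z ^ 2 * R ^ 2 / (R ^ 2 + z ^ 2) + 2 * z * R ^ 4 / (R ^ 2 + z ^ 2) ^ 2 * (w - z) - (w - z) ^ 2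
      ≤ w ^ 2 * R ^ 2 / (R ^ 2 + w ^ 2) := by
  have e : w ^ 2 * R ^ 2 / (R ^ 2 + w ^ 2) - (z ^ 2 * R ^ 2 / (R ^ 2 + z ^ 2)
      + 2 * z * R ^ 4 / (R ^ 2 + z ^ 2) ^ 2 * (w - z) - (w - z) ^ 2)
      = (w - z) ^ 2 * (((R ^ 2 + z ^ 2) ^ 2 * (R ^ 2 + w ^ 2)
        + R ^ 4 * (R ^ 2 - z ^ 2 - 2 * w * z)) / ((R ^ 2 + z ^ 2) ^ 2 * (R ^ 2 + w ^ 2))) := by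
    field_simp
    ring
  have hnum : 0 ≤ (R ^ 2 + z ^ 2) ^ 2 * (R ^ 2 + w ^ 2)
        + R ^ 4 * (R ^ 2 - z ^ 2 - 2 * w * z) := by
    have : (R ^ 2 + z ^ 2) ^ 2 * (R ^ 2 + w ^ 2) + R ^ 4 * (R ^ 2 - z ^ 2 - 2 * w * z)
      = R ^ 4 * (w - z) ^ 2 + 2 * R ^ 6 + 2 * R ^ 2 * z ^ 2 * w ^ 2 + R ^ 2 * z ^ 4
        + z ^ 4 * w ^ 2 := by ring
    rw [this]
    positivity
  have : 0 ≤ (w - z) ^ 2 * (((R ^ 2 + z ^ 2) ^ 2 * (R ^ 2 + w ^ 2)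
        + R ^ 4 * (R ^ 2 - z ^ 2 - 2 * w * z)) / ((R ^ 2 + z ^ 2) ^ 2 * (R ^ 2 + w ^ 2))) := by
    positivity
  linarith

/-- A quadratic lower bound for the mean time needed to reach a finite set. -/
lemma MomentBound.sq_le_mul_tsum_avoid {ε C : ℝ} (hm : Z.MomentBound ε C) (hε : 0 < ε) {N x : ℕ}
    {B : ℝ} (hB : 0 ≤ B)
    (h : ∀ z ∉ Set.Iic N, |2 * (z : ℝ) * natMoment Z 1 z| + natMoment Z 2 z ≤ B)
    (hx : x ∉ Set.Iic N) (hfin : ∑' n, Z.avoid (Set.Iic N) n x ≠ ⊤) :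
    ENNReal.ofReal ((x : ℝ) ^ 2)
      ≤ ENNReal.ofReal (2 * (N ^ 2 + B)) * ∑' n, Z.avoid (Set.Iic N) n x := by
  have hx0 : (0 : ℝ) < x := by
    have : N < x := not_le.1 hx
    exact_mod_cast (Nat.zero_le N).trans_lt this
  let u : ℕ → ℝ := fun w => (w : ℝ) ^ 2 * x ^ 2 / (x ^ 2 + w ^ 2)
  have hu0 (w : ℕ) : 0 ≤ u w := by positivity
  have hux (w : ℕ) : u w ≤ (x : ℝ) ^ 2 := by
    refine div_le_of_le_mul₀ (by positivity) (by positivity) ?_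
    nlinarith [sq_nonneg ((x : ℝ) ^ 2)]
  have huw (w : ℕ) : u w ≤ (w : ℝ) ^ 2 := by
    refine div_le_of_le_mul₀ (by positivity) (by positivity) ?_
    nlinarith [sq_nonneg ((w : ℝ) ^ 2)]
  have hui (z : ℕ) : Integrable u (Z.step z) :=
    Integrable.of_bound Measurable.of_discrete.aestronglyMeasurable ((x : ℝ) ^ 2)
      (Eventually.of_forall fun w => by rw [Real.norm_of_nonneg (hu0 w)]; exact hux w)
  have hdrift (z : ℕ) (hz : z ∉ Set.Iic N) : u z ≤ ∫ w, u w ∂Z.step z + B := by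
    set d : ℝ := 2 * z * (x : ℝ) ^ 4 / (x ^ 2 + (z : ℝ) ^ 2) ^ 2 with hd
    have hd0 : 0 ≤ d := by positivity
    have hdz : d ≤ 2 * z := by
      refine div_le_of_le_mul₀ (by positivity) (by positivity) ?_
      gcongr
      nlinarith [sq_nonneg ((x : ℝ) * z), sq_nonneg ((z : ℝ) ^ 2)]
    obtain ⟨qi, qe⟩ := hm.integral_quadratic hε z (u z) d (-1)
    have hle := integral_mono qi (hui z) fun w => by
      have := truncatedSq_taylor (z : ℝ) (w : ℝ) hx0
      simp only [u]
      linarith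
    rw [qe] at hle
    have hab : -(|2 * (z : ℝ) * natMoment Z 1 z|) ≤ d * natMoment Z 1 z := by
      have : |d * natMoment Z 1 z| ≤ |2 * (z : ℝ) * natMoment Z 1 z| := by
        rw [abs_mul, abs_mul, abs_of_nonneg hd0, abs_of_nonneg (show (0 : ℝ) ≤ 2 * z by positivity)]
        gcongr
      exact (neg_le_neg this).trans (neg_abs_le _)
    linarith [h z hz]
  have hone := one_le_tsum_avoid (Z := Z) (Set.Iic N) x
  have hmain : ENNReal.ofReal (u x)
      ≤ ENNReal.ofReal (N ^ 2) + ENNReal.ofReal B * ∑' n, Z.avoid (Set.Iic N) n x := by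
    refine le_add_mul_tsum_avoid (Z := Z) (u := fun w => ENNReal.ofReal (u w))
      (L := ENNReal.ofReal ((x : ℝ) ^ 2)) ENNReal.ofReal_ne_top
      (fun w => ENNReal.ofReal_le_ofReal (hux w))
      (fun a ha => ENNReal.ofReal_le_ofReal ((huw a).trans ?_)) (fun z hz => ?_) hx hfin
    · have : (a : ℝ) ≤ N := by exact_mod_cast ha
      gcongr
    · rw [lintegral_ofReal_step (hui z) hu0, ← ENNReal.ofReal_add (integral_nonneg hu0) hB]
      exact ENNReal.ofReal_le_ofReal (hdrift z hz)
  have hxx : (x : ℝ) ^ 2 = 2 * u x := by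
    simp only [u]
    field_simp
    ring
  rw [hxx, ENNReal.ofReal_mul zero_le_two, ENNReal.ofReal_mul zero_le_two,
    ENNReal.ofReal_add (by positivity) hB, mul_assoc]
  gcongr
  refine hmain.trans ?_
  rw [add_mul]
  gcongr
  exact le_mul_of_one_le_right zero_le hone

lemma MomentBound.not_positiveRecurrent (hirr : Z.Irreducible) {ε C : ℝ} (hm : Z.MomentBound ε C)
    (hε : 0 < ε) (hε1 : ε ≤ 1) {v δ D : ℝ} (hv : 0 < v) (hδ : 0 < δ) (hD : 0 ≤ D)
    (hvar : ∀ᶠ z : ℕ in atTop, v ≤ natMoment Z 2 z)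
    (h : ∀ᶠ z : ℕ in atTop,
      |2 * (1 + (z : ℝ)) * natMoment Z 1 z| ≤ natMoment Z 2 z + D * (1 + (z : ℝ)) ^ (-δ)) :
    ¬ Z.PositiveRecurrent := by
  set α := min ε δ / 4 with hαdef
  have hα : 0 < α := by positivity
  have hαε : 4 * α ≤ ε := by linarith [min_le_left ε δ]
  have hαδ : 4 * α ≤ δ := by linarith [min_le_right ε δ]
  obtain ⟨K, -, hK⟩ := hm.integral_rpow_two_sub hε hε1 hα (by linarith)
  have hC : 0 ≤ C := natMoment_two_nonneg (Z := Z) 0 |>.trans (hm.natMoment_two_le hε 0)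
  obtain ⟨N, hN⟩ := exists_finite_exceptional_set (h.and (hvar.and
    (((eventually_ge_atTop 1).and (eventually_mul_rpow_le 1 (b := -α) (by linarith)
      (show (0 : ℝ) < 1 / 2 by positivity))).and
    ((eventually_mul_rpow_le D (b := α - δ) (by linarith)
      (show 0 < α * v / 4 by positivity)).and
    (eventually_mul_rpow_le (K * C) (b := α - ε) (by linarith)
      (show 0 < α * v / 4 by positivity))))))
  let f : ℕ → ℝ := fun w => (1 + (w : ℝ)) ^ 2 - (1 + (w : ℝ)) ^ (2 - α)
  have hf0 (w : ℕ) : 0 ≤ f w := by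
    rw [sub_nonneg, ← Real.rpow_two]
    exact Real.rpow_le_rpow_of_exponent_le (by simp) (by linarith)
  have hfle (w : ℕ) : f w ≤ (1 + (w : ℝ)) ^ 2 := sub_le_self _ (by positivity)
  have hpow (w : ℕ) : (1 + (w : ℝ)) ^ (2 - α) = (1 + (w : ℝ)) ^ (-α) * (1 + (w : ℝ)) ^ 2 := by
    rw [← Real.rpow_two, ← Real.rpow_add (by positivity)]
    congr 1
    ring
  have hdrift (z : ℕ) (hz : z ∉ Set.Iic N) :
      Integrable f (Z.step z) ∧ f z ≤ ∫ w, f w ∂Z.step z := by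
    obtain ⟨hμ, hv2, ⟨hz1, hhalf⟩, e1, e2⟩ := hN z hz
    obtain ⟨i1, b1⟩ := hK z
    have hpz := hpow z
    set y : ℝ := 1 + z with hy
    have hy0 : 0 < y := by positivity
    obtain ⟨qi, qe⟩ := hm.integral_quadratic hε z (y ^ 2) (2 * y) 1
    have i2 := i1.const_mul (y ^ (2 - α))
    have hfeq : f = fun w : ℕ => (y ^ 2 + 2 * y * ((w : ℝ) - z) + 1 * ((w : ℝ) - z) ^ 2)
        - y ^ (2 - α) * ((1 + (w : ℝ)) / y) ^ (2 - α) := by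
      ext w
      simp only [f]
      rw [one_add_rpow_eq w z, hy]
      ring
    have hfz : f z = y ^ 2 - y ^ (2 - α) := rfl
    refine ⟨hfeq ▸ qi.sub i2, ?_⟩
    rw [hfz, hfeq, integral_sub qi i2, qe, integral_const_mul]
    set I := ∫ w : ℕ, ((1 + (w : ℝ)) / y) ^ (2 - α) ∂Z.step z
    set m₁ := natMoment Z 1 z
    set m₂ := natMoment Z 2 z
    set s := y ^ (-α) with hs
    have hs0 : 0 < s := by positivity
    have hs1 : s ≤ 1 := by linarith
    have hP : y ^ (-δ) = s * y ^ (α - δ) := by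
      rw [hs, ← Real.rpow_add hy0]; congr 1; ring
    have hI : y ^ (2 - α) * (I - 1) ≤ s * ((2 - α) * (y * m₁) + (2 - α) * (1 - α) / 2 * m₂
        + K * C * y ^ (α - ε)) := by
      have u := mul_le_mul_of_nonneg_left (abs_le.1 b1).2 (by positivity : 0 ≤ s * y ^ 2)
      rw [hpz]
      have e : s * y ^ 2 * (K * C * y ^ (α - ε) / y ^ 2) = s * (K * C * y ^ (α - ε)) := by
        field_simp
      have e' : s * y ^ 2 * (I - (1 + (2 - α) * (m₁ / y) + (2 - α) * (1 - α) / 2 * (m₂ / y ^ 2)))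
          = s * y ^ 2 * (I - 1) - s * ((2 - α) * (y * m₁) + (2 - α) * (1 - α) / 2 * m₂) := by
        field_simp
        ring
      rw [e, e'] at u
      linarith
    have hα1 : α ≤ 1 := by linarith
    have hR : 0 ≤ D * y ^ (-δ) := by positivity
    have hco0 : 0 ≤ 1 - s * (1 - α / 2) := by nlinarith
    have hco1 : 1 - s * (1 - α / 2) ≤ 1 := by nlinarith
    have c1 : -(s * (D * y ^ (α - δ))) ≤ (2 * y * m₁ + m₂) * (1 - s * (1 - α / 2)) := by
      have k : s * (D * y ^ (α - δ)) = D * y ^ (-δ) := by rw [hP]; ring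
      rw [k]
      have : -(D * y ^ (-δ)) ≤ 2 * y * m₁ + m₂ := by linarith [(abs_le.1 hμ).1]
      nlinarith
    have c2 := mul_le_mul_of_nonneg_left e1 hs0.le
    have c3 := mul_le_mul_of_nonneg_left e2 hs0.le
    have c4 : s * (1 / 2 * (α * v)) ≤ s * ((1 - α / 2) * (α * m₂)) := by
      gcongr <;> linarith
    linarith
  have hmass (z : ℕ) (hz : z ∉ Set.Iic N) :
      |2 * (z : ℝ) * natMoment Z 1 z| + natMoment Z 2 z ≤ 2 * C + D := by
    have hm2 := hm.natMoment_two_le hε z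
    have h1 : (1 + (z : ℝ)) ^ (-δ) ≤ 1 :=
      Real.rpow_le_one_of_one_le_of_nonpos (by simp) (by linarith)
    have h2 : |2 * (z : ℝ) * natMoment Z 1 z| ≤ |2 * (1 + (z : ℝ)) * natMoment Z 1 z| := by
      rw [abs_mul, abs_mul (2 * (1 + (z : ℝ))), abs_of_nonneg (show (0 : ℝ) ≤ 2 * z by positivity),
        abs_of_nonneg (show (0 : ℝ) ≤ 2 * (1 + z) by positivity)]
      gcongr
      linarith
    have h3 := mul_le_of_le_one_right hD h1
    linarith [(hN z hz).1]
  have hbig : ((2 * N + 2 : ℕ)) ∉ Set.Iic N := by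
    simp only [Set.mem_Iic, not_le]
    omega
  refine Z.not_positiveRecurrent_of_subharmonic hirr (A := Set.Iic N) ⟨N, Set.self_mem_Iic⟩
    (f := fun w => ENNReal.ofReal (f w)) (M := ENNReal.ofReal ((1 + (N : ℝ)) ^ 2))
    (K := ENNReal.ofReal 4 * ENNReal.ofReal (2 * (N ^ 2 + (2 * C + D))))
    (by finiteness) (fun a ha => ENNReal.ofReal_le_ofReal ((hfle a).trans ?_))
    (fun z hz => ?_) (fun hpos z hz => ?_) hbig ?_
  · have : (a : ℝ) ≤ N := by exact_mod_cast ha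
    gcongr
  · rw [lintegral_ofReal_step (hdrift z hz).1 hf0]
    exact ENNReal.ofReal_le_ofReal (hdrift z hz).2
  · have hz1 : (1 : ℝ) ≤ z := by exact_mod_cast (hN z hz).2.2.1.1
    calc ENNReal.ofReal (f z) ≤ ENNReal.ofReal (4 * (z : ℝ) ^ 2) :=
          ENNReal.ofReal_le_ofReal ((hfle z).trans (by nlinarith))
      _ = ENNReal.ofReal 4 * ENNReal.ofReal ((z : ℝ) ^ 2) := ENNReal.ofReal_mul (by norm_num)
      _ ≤ _ := by
        rw [mul_assoc]
        gcongr
        exact hm.sq_le_mul_tsum_avoid hε (by positivity) hmass hz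
          (hpos.tsum_avoid_ne_top hirr ⟨N, Set.self_mem_Iic⟩ z)
  · have hhalf := (hN _ hbig).2.2.1.2
    rw [one_mul] at hhalf
    refine (ENNReal.ofReal_lt_ofReal_iff_of_nonneg (by positivity)).2 ?_
    simp only [f]
    rw [hpow]
    have h1 := mul_le_mul_of_nonneg_right hhalf (sq_nonneg (1 + ((2 * N + 2 : ℕ) : ℝ)))
    have h2 : (1 + (N : ℝ)) ^ 2 < 1 / 2 * (1 + ((2 * N + 2 : ℕ) : ℝ)) ^ 2 := by
      push_cast
      nlinarith [(Nat.cast_nonneg N : (0 : ℝ) ≤ N)]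
    linarith

end MChain

/-- Lamperti's recurrence criterion for an irreducible Markov chain on `ℕ` with uniformly
bounded `(2+ε)`-moments and non-degenerate second moments. -/
theorem stmt15 (Z : MChain ℕ) (hirr : Z.Irreducible)
    (hmom : ∃ ε : ℝ, 0 < ε ∧ ∃ C : ℝ≥0∞, C ≠ ⊤ ∧ ∀ z : ℕ,
      (∫⁻ ω, ENNReal.ofReal (|(ω 1 : ℝ) - (z : ℝ)| ^ (2 + ε)) ∂(Z.P z)) ≤ C)
    (hvar : 0 < Filter.atTop.liminf fun z : ℕ => natMoment Z 2 z) :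
    ((0 < Filter.atTop.liminf fun z : ℕ =>
        2 * (z : ℝ) * natMoment Z 1 z - natMoment Z 2 z) → Z.Transient) ∧
    ((∃ δ C : ℝ, 0 < δ ∧ ∀ᶠ z : ℕ in atTop,
        |2 * (z : ℝ) * natMoment Z 1 z| ≤ natMoment Z 2 z + C * (z : ℝ) ^ (-δ)) →
      Z.NullRecurrent) ∧
    ((Filter.atTop.limsup fun z : ℕ =>
        2 * (z : ℝ) * natMoment Z 1 z + natMoment Z 2 z) < 0 → Z.PositiveRecurrent) := by
  obtain ⟨ε, C, hε, hε1, hC, hm⟩ := MChain.exists_momentBound hmom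
  obtain ⟨v, hv, hvar⟩ := exists_pos_eventually_le_of_liminf_pos hvar
  refine ⟨fun h => ?_, fun h => ?_, fun h => ?_⟩
  · obtain ⟨c, hc, h⟩ := exists_pos_eventually_le_of_liminf_pos h
    exact hm.transient hirr hε hε1 hC hc h
  · obtain ⟨δ, D, hδ, h⟩ := h
    obtain ⟨δ', D', hδ', hD', h⟩ := hm.exists_drift_bound hε hC hδ h
    exact ⟨hm.recurrent hirr hε hε1 hv hδ' hD' hvar h,
      hm.not_positiveRecurrent hirr hε hε1 hv hδ' hD' hvar h⟩
  · obtain ⟨c, hc, h⟩ := exists_pos_eventually_le_neg_of_limsup_neg h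
    exact hm.positiveRecurrent hirr hε hc h
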